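/- arXiv:1912.10378 — 3 statements merged into one kernel-verified Lean document; each statement's English description precedes it below -/
import Mathlib

section
/- Let f and Φ be non-trivial functions in OM_+^1 such that f is σ_Φ-subpreserving. If f(0) = 0, then Φ(0) = 0. -/
open Matrix Filter Set Topology
open scoped ComplexOrder

noncomputable def matFun {n : ℕ} (f : ℝ → ℝ) (A : Matrix (Fin n) (Fin n) ℂ) :
    Matrix (Fin n) (Fin n) ℂ := cfc f A

def loewnerLE {n : ℕ} (A B : Matrix (Fin n) (Fin n) ℂ) : Prop := (B - A).PosSemidef

def OpMonotone (f : ℝ → ℝ) : Prop :=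
  ∀ (n : ℕ) (A B : Matrix (Fin n) (Fin n) ℂ), A.PosDef → B.PosDef →
    loewnerLE A B → loewnerLE (matFun f A) (matFun f B)

def OMone (f : ℝ → ℝ) : Prop :=
  (∀ t : ℝ, 0 < t → 0 < f t) ∧ f 1 = 1 ∧ OpMonotone f

noncomputable def kuboMean {n : ℕ} (Φ : ℝ → ℝ) (A B : Matrix (Fin n) (Fin n) ℂ) :
    Matrix (Fin n) (Fin n) ℂ :=
  matFun Real.sqrt A *
    matFun Φ (matFun (fun x => (Real.sqrt x)⁻¹) A * B * matFun (fun x => (Real.sqrt x)⁻¹) A) *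
    matFun Real.sqrt A

def Subpreserves (Φ f : ℝ → ℝ) : Prop :=
  ∀ (n : ℕ) (A B : Matrix (Fin n) (Fin n) ℂ), A.PosDef → B.PosDef →
    loewnerLE (matFun f (kuboMean Φ A B)) (kuboMean Φ (matFun f A) (matFun f B))

def PreservesMean (Φ f : ℝ → ℝ) : Prop :=
  ∀ (n : ℕ) (A B : Matrix (Fin n) (Fin n) ℂ), A.PosDef → B.PosDef →
    matFun f (kuboMean Φ A B) = kuboMean Φ (matFun f A) (matFun f B)

def OMTrivial (f : ℝ → ℝ) : Prop :=
  (∀ t : ℝ, 0 < t → f t = 1) ∨ (∀ t : ℝ, 0 < t → f t = t)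

noncomputable def adjFun (f : ℝ → ℝ) : ℝ → ℝ := fun t => (f t⁻¹)⁻¹

noncomputable def transFun (f : ℝ → ℝ) : ℝ → ℝ := fun t => t * f t⁻¹

theorem matFun_algebraMap {n : ℕ} (f : ℝ → ℝ) (a : ℝ) :
    matFun f (algebraMap ℝ (Matrix (Fin n) (Fin n) ℂ) a) = algebraMap ℝ _ (f a) :=
  cfc_algebraMap a f

theorem loewnerLE_algebraMap_iff {a b : ℝ} :
    loewnerLE (algebraMap ℝ (Matrix (Fin 1) (Fin 1) ℂ) a) (algebraMap ℝ _ b) ↔ a ≤ b := by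
  unfold loewnerLE
  rw [← map_sub]
  constructor
  · intro h
    have := h.diag_nonneg (i := 0)
    rw [Matrix.algebraMap_matrix_apply] at this
    simpa using this
  · intro h
    rw [Algebra.algebraMap_eq_smul_one]
    exact Matrix.PosSemidef.one.smul (sub_nonneg.2 h)

theorem posDef_algebraMap {n : ℕ} {a : ℝ} (ha : 0 < a) :
    (algebraMap ℝ (Matrix (Fin n) (Fin n) ℂ) a).PosDef := by
  rw [Algebra.algebraMap_eq_smul_one]
  exact Matrix.PosDef.one.smul ha

theorem kuboMean_algebraMap {n : ℕ} (Φ : ℝ → ℝ) {a : ℝ} (ha : 0 < a) (b : ℝ) :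
    kuboMean Φ (algebraMap ℝ (Matrix (Fin n) (Fin n) ℂ) a) (algebraMap ℝ _ b) =
      algebraMap ℝ _ (a * Φ (b / a)) := by
  have hs : √a ≠ 0 := (Real.sqrt_pos.2 ha).ne'
  have hss : √a * √a = a := Real.mul_self_sqrt ha.le
  simp only [kuboMean, matFun_algebraMap, ← map_mul]
  congr 1
  have h : (√a)⁻¹ * b * (√a)⁻¹ = b / a := by
    rw [mul_right_comm, ← mul_inv, hss, inv_mul_eq_div]
  rw [h, mul_right_comm, hss]

theorem OpMonotone.monotoneOn {f : ℝ → ℝ} (hf : OpMonotone f) : MonotoneOn f (Ioi 0) := by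
  intro a ha b hb hab
  have := hf 1 _ _ (posDef_algebraMap ha) (posDef_algebraMap hb)
    (loewnerLE_algebraMap_iff.2 hab)
  rwa [matFun_algebraMap, matFun_algebraMap, loewnerLE_algebraMap_iff] at this

theorem Subpreserves.scalar {Φ f : ℝ → ℝ} (h : Subpreserves Φ f)
    (hpos : ∀ t, 0 < t → 0 < f t) {a b : ℝ} (ha : 0 < a) (hb : 0 < b) :
    f (a * Φ (b / a)) ≤ f a * Φ (f b / f a) := by
  have := h 1 _ _ (posDef_algebraMap ha) (posDef_algebraMap hb)
  rwa [kuboMean_algebraMap Φ ha, matFun_algebraMap, matFun_algebraMap, matFun_algebraMap,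
    kuboMean_algebraMap Φ (hpos a ha), loewnerLE_algebraMap_iff] at this

theorem matFun_combination {n : ℕ} (f : ℝ → ℝ) {P : Matrix (Fin n) (Fin n) ℂ}
    (hP : IsStarProjection P) (a b : ℝ) :
    matFun f (b • (1 : Matrix (Fin n) (Fin n) ℂ) + (a - b) • P) =
      f b • (1 : Matrix (Fin n) (Fin n) ℂ) + (f a - f b) • P := by
  have hsa : IsSelfAdjoint P := hP.isSelfAdjoint
  have hspec : spectrum ℝ P ⊆ {0, 1} := hP.isIdempotentElem.spectrum_subset ℝ
  have key : ∀ x y : ℝ, cfc (fun t : ℝ => x + y * t) P =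
      x • (1 : Matrix (Fin n) (Fin n) ℂ) + y • P := by
    intro x y
    rw [cfc_const_add x (fun t => y * t) P, cfc_const_mul_id y P,
      Algebra.algebraMap_eq_smul_one]
  have hfin : (spectrum ℝ P).Finite := (Set.toFinite {0, 1}).subset hspec
  unfold matFun
  rw [← key, ← key, ← cfc_comp' f (fun t : ℝ => b + (a - b) * t) P
    (hg := (hfin.image _).continuousOn _)]
  refine cfc_congr fun t ht => ?_
  rcases hspec ht with rfl | rfl <;> simp

theorem posDef_combination {n : ℕ} {P : Matrix (Fin n) (Fin n) ℂ}
    (hP : IsStarProjection P) {a b : ℝ} (ha : 0 < a) (hb : 0 < b) :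
    (b • (1 : Matrix (Fin n) (Fin n) ℂ) + (a - b) • P).PosDef := by
  have psd : ∀ {Q : Matrix (Fin n) (Fin n) ℂ}, IsStarProjection Q → Q.PosSemidef := by
    intro Q hQ
    have h := Matrix.posSemidef_conjTranspose_mul_self Q
    rwa [← Matrix.star_eq_conjTranspose, hQ.isSelfAdjoint.star_eq,
      hQ.isIdempotentElem.eq] at h
  rcases le_total b a with h | h
  · exact (Matrix.PosDef.one.smul hb).add_posSemidef ((psd hP).smul (sub_nonneg.2 h))
  · have := (Matrix.PosDef.one.smul ha).add_posSemidef
      ((psd hP.one_sub).smul (sub_nonneg.2 h))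
    convert this using 1
    module

theorem isStarProjection_fin_two {s r : ℝ} (h : r * r = s * (1 - s)) :
    IsStarProjection (!![(s : ℂ), r; r, 1 - s] : Matrix (Fin 2) (Fin 2) ℂ) := by
  have h' : (r : ℂ) * r = s * (1 - s) := by exact_mod_cast h
  constructor
  · unfold IsIdempotentElem
    ext i j
    fin_cases i <;> fin_cases j <;> simp [Matrix.mul_apply, Fin.sum_univ_two, h'] <;> ring
  · unfold IsSelfAdjoint
    ext i j
    fin_cases i <;> fin_cases j <;> simp [Matrix.star_apply]

theorem OpMonotone.combination_le {f : ℝ → ℝ} (hf : OpMonotone f) {a b s u : ℝ}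
    (ha : 0 < a) (hb : 0 < b) (hs0 : 0 ≤ s) (hs1 : s ≤ 1) (hu : s * a + (1 - s) * b < u) :
    s * f a + (1 - s) * f b ≤ f u := by
  obtain ⟨r, hr⟩ : ∃ r : ℝ, r * r = s * (1 - s) :=
    ⟨_, Real.mul_self_sqrt (mul_nonneg hs0 (sub_nonneg.2 hs1))⟩
  have hP := isStarProjection_fin_two hr
  have hQ := isStarProjection_fin_two (s := 1) (r := 0) (by simp)
  set δ := u - (s * a + (1 - s) * b) with hδ
  have hδ0 : 0 < δ := sub_pos.2 hu
  have hu0 : 0 < u := lt_of_le_of_lt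
    (add_nonneg (mul_nonneg hs0 ha.le) (mul_nonneg (sub_nonneg.2 hs1) hb.le)) hu
  set m := (a - b) * r with hm
  set l := (1 - s) * a + s * b + m * m / δ with hl
  have hl0 : 0 < l := by
    have h1 : 0 ≤ m * m / δ := div_nonneg (mul_self_nonneg m) hδ0.le
    have h2 : 0 < (1 - s) * a + s * b := by
      rcases hs0.eq_or_lt with rfl | h
      · simpa using ha
      · exact add_pos_of_nonneg_of_pos (mul_nonneg (sub_nonneg.2 hs1) ha.le) (mul_pos h hb)
    linarith
  have hle := hf 2 _ _ (posDef_combination hP ha hb) (posDef_combination hQ hu0 hl0) ?_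
  · rw [matFun_combination f hP, matFun_combination f hQ] at hle
    have h0 := hle.diag_nonneg (i := 0)
    simp only [Matrix.sub_apply, Matrix.add_apply, Matrix.smul_apply] at h0
    simp at h0
    norm_cast at h0
    linarith
  · have hsq : √δ * √δ = δ := Real.mul_self_sqrt hδ0.le
    have hsq0 : √δ ≠ 0 := (Real.sqrt_pos.2 hδ0).ne'
    have hv := Matrix.posSemidef_vecMulVec_self_star ![((√δ : ℝ) : ℂ), ((-m / √δ : ℝ) : ℂ)]
    unfold loewnerLE
    convert hv using 1
    have e1 : √δ * (-m / √δ) = -m := by field_simp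
    have e2 : (-m / √δ) * (-m / √δ) = m * m / δ := by
      rw [div_mul_div_comm, hsq, neg_mul_neg]
    ext i j
    fin_cases i <;> fin_cases j <;>
      simp [Matrix.vecMulVec_apply, -Complex.ofReal_div, -Complex.ofReal_neg] <;> norm_cast
    · rw [hsq, hδ]; ring
    · rw [e1, hm]
    · rw [mul_comm (-m / √δ), e1, hm]
    · rw [e2, hl]; ring

theorem OMone.antitoneOn_div {f : ℝ → ℝ} (hf : OMone f) :
    AntitoneOn (fun t => f t / t) (Ioi 0) := by
  intro u hu b hb hub
  rw [mem_Ioi] at hu hb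
  rcases hub.eq_or_lt with rfl | hub
  · exact le_rfl
  have key : ∀ x : ℝ, 0 < x → x < u / b → x * f b ≤ f u := by
    intro x hx hxu
    have hx1 : x < 1 := hxu.trans ((div_lt_one hb).2 hub)
    have hgap : 0 < u - x * b := sub_pos.2 ((lt_div_iff₀ hb).1 hxu)
    have ha : 0 < (u - x * b) / 2 := half_pos hgap
    have h := hf.2.2.combination_le (s := 1 - x) (u := u) ha hb (by linarith) (by linarith)
      (by nlinarith)
    have := mul_nonneg (sub_nonneg.2 hx1.le) (hf.1 _ ha).le
    simp only [sub_sub_cancel] at h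
    linarith
  have hfb := hf.1 b hb
  have : u / b ≤ f u / f b := by
    refine le_of_forall_lt_imp_le_of_dense fun x hx => ?_
    rcases le_or_gt x 0 with h | h
    · exact h.trans (div_nonneg (hf.1 u hu).le hfb.le)
    · exact (le_div_iff₀ hfb).2 (key x h hx)
  show f b / b ≤ f u / u
  rw [div_le_div_iff₀ hb hu]
  rw [div_le_div_iff₀ hb hfb] at this
  linarith

theorem OMone.eq_one_of_one_le {f : ℝ → ℝ} (hf : OMone f) (h : ∀ t, 0 < t → 1 ≤ f t)
    {t : ℝ} (ht : 0 < t) : f t = 1 := by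
  refine le_antisymm ?_ (h t ht)
  rcases le_or_gt t 1 with ht1 | ht1
  · exact hf.2.1 ▸ hf.2.2.monotoneOn ht (mem_Ioi.2 one_pos) ht1
  have hx : 0 < (4 * t)⁻¹ := by positivity
  have hx1 : (4 * t)⁻¹ ≤ 1 := inv_le_one_of_one_le₀ (by linarith)
  have hxt : (4 * t)⁻¹ * t = 1 / 4 := by field_simp
  have hc := hf.2.2.combination_le (a := 1 / 4) (b := t) (s := 1 - (4 * t)⁻¹) (u := 1)
    (by norm_num) ht (by linarith) (by linarith) (by nlinarith)
  have := mul_le_mul_of_nonneg_left (h (1 / 4) (by norm_num)) (sub_nonneg.2 hx1)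
  rw [hf.2.1, sub_sub_cancel] at hc
  exact le_of_mul_le_mul_left (by linarith) hx

theorem OMone.eq_id_of_map_mul_le {f : ℝ → ℝ} (hf : OMone f) {c : ℝ} (hc : 0 < c) (hc1 : c < 1)
    (h : ∀ t, 0 < t → f (c * t) ≤ c * f t) {t : ℝ} (ht : 0 < t) : f t = t := by
  have hg := hf.antitoneOn_div
  have step : ∀ x, 0 < x → f (c * x) / (c * x) = f x / x := by
    intro x hx
    refine le_antisymm ?_ (hg (mul_pos hc hx) hx (by nlinarith))
    rw [div_le_div_iff₀ (mul_pos hc hx) hx]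
    nlinarith [h x hx]
  have iter : ∀ (n : ℕ) x, 0 < x → f (c ^ n * x) / (c ^ n * x) = f x / x := by
    intro n x hx
    induction n with
    | zero => simp
    | succ k ih => rw [pow_succ', mul_assoc, step _ (by positivity), ih]
  have h1 : f 1 / 1 = 1 := by rw [hf.2.1, div_one]
  have hle : f t / t ≤ 1 := by
    obtain ⟨n, hn⟩ := exists_pow_lt_of_lt_one ht hc1
    rw [← h1, ← iter n 1 one_pos]
    exact hg (mem_Ioi.2 (by positivity)) ht (by linarith)
  have hge : 1 ≤ f t / t := by
    obtain ⟨n, hn⟩ := exists_pow_lt_of_lt_one (inv_pos.2 ht) hc1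
    rw [← iter n t ht, ← h1]
    refine hg (mem_Ioi.2 (by positivity)) (mem_Ioi.2 one_pos) ?_
    have := mul_lt_mul_of_pos_right hn ht
    rw [inv_mul_cancel₀ ht.ne'] at this
    exact this.le
  exact (div_eq_one_iff_eq ht.ne').1 (le_antisymm hle hge)

theorem stmt_2 (f Φ : ℝ → ℝ) (hf : OMone f) (hΦ : OMone Φ)
    (hfnt : ¬ OMTrivial f) (hΦnt : ¬ OMTrivial Φ)
    (hsub : Subpreserves Φ f)
    (hf0 : Filter.Tendsto f (nhdsWithin 0 (Set.Ioi 0)) (nhds 0)) :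
    Filter.Tendsto Φ (nhdsWithin 0 (Set.Ioi 0)) (nhds 0) := by
  have hbdd : BddBelow (Φ '' Ioi 0) :=
    ⟨0, by rintro _ ⟨t, ht, rfl⟩; exact (hΦ.1 t ht).le⟩
  have hlim := hΦ.2.2.monotoneOn.tendsto_nhdsGT hbdd
  set c := sInf (Φ '' Ioi 0)
  have hc0 : 0 ≤ c := Real.sInf_nonneg (by rintro _ ⟨t, ht, rfl⟩; exact (hΦ.1 t ht).le)
  have hcle : ∀ t, 0 < t → c ≤ Φ t := fun t ht => csInf_le hbdd ⟨t, ht, rfl⟩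
  rcases hc0.eq_or_lt with h | hc
  · rwa [← h] at hlim
  exfalso
  rcases (hΦ.2.1 ▸ hcle 1 one_pos : c ≤ 1).eq_or_lt with hc1 | hc1
  · exact hΦnt (Or.inl fun t ht => hΦ.eq_one_of_one_le (hc1 ▸ hcle) ht)
  refine hfnt (Or.inr fun t ht => hf.eq_id_of_map_mul_le hc hc1 (fun a ha => ?_) ht)
  have hratio : Tendsto (fun b => f b / f a) (𝓝[>] 0) (𝓝[>] 0) := by
    refine tendsto_nhdsWithin_iff.2 ⟨by simpa using hf0.div_const (f a), ?_⟩
    filter_upwards [self_mem_nhdsWithin] with b hb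
    exact div_pos (hf.1 b hb) (hf.1 a ha)
  have hrhs := (hlim.comp hratio).const_mul (f a)
  rw [mul_comm c (f a)]
  refine ge_of_tendsto hrhs ?_
  filter_upwards [self_mem_nhdsWithin] with b hb
  have hca := hcle (b / a) (div_pos hb ha)
  refine le_trans ?_ (hsub.scalar hf.1 ha hb)
  rw [mul_comm c a]
  exact hf.2.2.monotoneOn (mul_pos ha hc) (mul_pos ha (hc.trans_le hca))
    (mul_le_mul_of_nonneg_left hca ha.le)
end

section
/- Let f ∈ OM_+^1 and let Φ ∈ OM_+^1 be non-trivial with Φ*(0) = 0. If f is σ_Φ-subpreserving and f(0) = 0, then f(t) = t for all t ∈ [0,∞). -/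
open Matrix Filter Set Topology
open scoped ComplexOrder

theorem concaveOn_of_forall_pos {g : ℝ → ℝ} (hpos : ∀ t, 0 < t → 0 < g t)
    (h : ∀ x y θ ε : ℝ, 0 < x → 0 < y → 0 < θ → θ < 1 → 0 < ε →
      θ * g x + (1 - θ) * g y ≤ g (θ * x + (1 - θ) * y + ε)) :
    ConcaveOn ℝ (Ioi 0) g := by
  have jump : ∀ m θ : ℝ, 0 < m → 0 < θ → θ < 1 → (1 - θ) * g (m + θ * (m / 2)) ≤ g m := by
    intro m θ hm h0 h1
    have h2 := h (m - m / 2) (m + θ * (m / 2)) θ (θ ^ 2 * (m / 2)) (by linarith) (by positivity)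
      h0 h1 (by positivity)
    rw [show θ * (m - m / 2) + (1 - θ) * (m + θ * (m / 2)) + θ ^ 2 * (m / 2) = m by ring] at h2
    have := mul_pos h0 (hpos (m - m / 2) (by linarith))
    linarith
  refine concaveOn_iff_pairwise_pos.2 ⟨convex_Ioi 0, ?_⟩
  intro x hx y hy _ a b ha hb hab
  obtain rfl : b = 1 - a := by linarith
  simp only [smul_eq_mul, mem_Ioi] at *
  set m := a * x + (1 - a) * y
  set L := a * g x + (1 - a) * g y
  have hm : 0 < m := by positivity
  have hL : 0 < L := add_pos (mul_pos ha (hpos x hx)) (mul_pos hb (hpos y hy))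
  have key : ∀ θ : ℝ, 0 < θ → θ < 1 → (1 - θ) * L ≤ g m := fun θ h0 h1 =>
    (mul_le_mul_of_nonneg_left (h x y a (θ * (m / 2)) hx hy ha (by linarith) (by positivity))
      (by linarith)).trans (jump m θ hm h0 h1)
  by_contra! hlt
  have hgm := hpos m hm
  have h2 := key ((L - g m) / (2 * L)) (by apply div_pos <;> linarith)
    (by rw [div_lt_one (by linarith)]; linarith)
  have h3 : (1 - (L - g m) / (2 * L)) * L = (L + g m) / 2 := by field_simp; ring
  linarith

theorem ConcaveOn.mul_le_mul_of_pos {g : ℝ → ℝ} (hc : ConcaveOn ℝ (Ioi 0) g)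
    (hpos : ∀ t, 0 < t → 0 < g t) {u v : ℝ} (hu : 0 < u) (huv : u ≤ v) :
    u * g v ≤ v * g u := by
  rcases huv.eq_or_lt with rfl | huv
  · exact le_rfl
  have hv := hu.trans huv
  refine le_of_forall_pos_lt_add fun δ hδ => ?_
  have hgv := hpos v hv
  have hgu := hpos u hu
  obtain ⟨ε, hε, hεu, hεδ⟩ : ∃ ε, 0 < ε ∧ ε < u ∧ ε * g v < δ := by
    refine ⟨min (u / 2) (δ / (2 * g v)), by positivity, (min_le_left _ _).trans_lt (by linarith), ?_⟩
    calc _ ≤ δ / (2 * g v) * g v := by gcongr; exact min_le_right _ _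
      _ = δ / 2 := by field_simp
      _ < δ := by linarith
  have hvε : 0 < v - ε := by linarith
  have h := hc.2 (show ε ∈ Ioi (0 : ℝ) from hε) (show v ∈ Ioi (0 : ℝ) from hv)
    (show 0 ≤ (v - u) / (v - ε) by apply div_nonneg <;> linarith)
    (show 0 ≤ (u - ε) / (v - ε) by apply div_nonneg <;> linarith) (by field_simp; ring)
  simp only [smul_eq_mul] at h
  rw [show (v - u) / (v - ε) * ε + (u - ε) / (v - ε) * v = u by field_simp; ring] at h
  have h1 : 0 ≤ (v - u) / (v - ε) * g ε :=
    mul_nonneg (by apply div_nonneg <;> linarith) (hpos ε hε).le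
  have h2 : (u - ε) / (v - ε) * g v ≤ g u := by linarith
  rw [div_mul_eq_mul_div, div_le_iff₀ hvε] at h2
  nlinarith

/-- The scalar part of the argument: `hmean` is what the operator inequality gives
for the corner entry of a real symmetric 2 by 2 matrix. -/
theorem eq_id_or_eq_id_of_mean_le {f Φ : ℝ → ℝ} (hfpos : ∀ t, 0 < t → 0 < f t) (hf1 : f 1 = 1)
    (hfmono : ∀ x y, 0 < x → x ≤ y → f x ≤ f y) (hfc : ConcaveOn ℝ (Ioi 0) f)
    (hΦpos : ∀ t, 0 < t → 0 < Φ t) (hΦ1 : Φ 1 = 1) (hΦc : ConcaveOn ℝ (Ioi 0) Φ)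
    (hf0 : Tendsto f (𝓝[>] 0) (𝓝 0))
    (hmean : ∀ x y θ s a a' : ℝ, 0 < x → 0 < y → 0 < θ → θ < 1 → 0 < s →
      a = θ * x + (1 - θ) * y → a' = θ * f x + (1 - θ) * f y →
      f (a * Φ (s / a)) ≤ a' * Φ (f s / a')) :
    (∀ t, 0 < t → f t = t) ∨ (∀ t, 0 < t → Φ t = t) := by
  by_cases hid : ∀ t, 0 < t → f t = t
  · exact Or.inl hid
  right
  have hΦa : ∀ {u v : ℝ}, 0 < u → u ≤ v → u * Φ v ≤ v * Φ u := hΦc.mul_le_mul_of_pos hΦpos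
  obtain ⟨a₀, b₀, ha₀, hab₀, hlt⟩ : ∃ a b, 0 < a ∧ a < b ∧ f b / b < f a / a := by
    push Not at hid
    obtain ⟨t, ht, hne⟩ := hid
    rcases lt_trichotomy t 1 with h | rfl | h
    · refine ⟨t, 1, ht, h, ?_⟩
      have := hfc.mul_le_mul_of_pos hfpos ht h.le
      rw [hf1] at this ⊢
      rw [div_one, lt_div_iff₀ ht]
      exact lt_of_le_of_ne (by linarith) (by simpa using hne.symm)
    · exact absurd hf1 hne
    · refine ⟨1, t, one_pos, h, ?_⟩
      have := hfc.mul_le_mul_of_pos hfpos one_pos h.le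
      rw [hf1] at this ⊢
      rw [div_one, div_lt_iff₀ ht]
      exact lt_of_le_of_ne (by linarith) (by simpa using hne)
  obtain ⟨κ, hκ1, hκ2⟩ := exists_between hlt
  have hb₀ : 0 < b₀ := ha₀.trans hab₀
  have hκ : 0 < κ := (div_pos (hfpos b₀ hb₀) hb₀).trans hκ1
  have step : ∀ t, 1 ≤ t → t ≤ Φ t → f a₀ / a₀ / κ * t ≤ Φ (f a₀ / a₀ / κ * t) := by
    intro t ht hΦt
    have ht0 : 0 < t := one_pos.trans_le ht
    obtain ⟨c, hc⟩ : ∃ c, c = a₀ / t := ⟨_, rfl⟩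
    have hc0 : 0 < c := hc ▸ div_pos ha₀ ht0
    have hct : c * t = a₀ := by rw [hc]; field_simp
    have hcb : c < b₀ := by nlinarith
    have hgap : 0 < c * κ - c / b₀ * f b₀ := by
      have : c * (f b₀ / b₀) < c * κ := by gcongr
      rw [div_mul_eq_mul_div, mul_div_assoc]
      linarith
    obtain ⟨ε, hε0, hε⟩ : ∃ ε : ℝ, 0 < ε ∧ f ε < c * κ - c / b₀ * f b₀ :=
      (Filter.Eventually.and (eventually_mem_nhdsWithin (a := (0 : ℝ)) (s := Ioi 0))
        (hf0.eventually_lt_const hgap)).exists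
    have hθ0 : 0 < c / b₀ := div_pos hc0 hb₀
    have hθ1 : c / b₀ < 1 := (div_lt_one hb₀).2 hcb
    obtain ⟨a, ha⟩ : ∃ a, a = c / b₀ * b₀ + (1 - c / b₀) * ε := ⟨_, rfl⟩
    obtain ⟨a', ha'⟩ : ∃ a', a' = c / b₀ * f b₀ + (1 - c / b₀) * f ε := ⟨_, rfl⟩
    have h := hmean b₀ ε (c / b₀) a₀ a a' hb₀ hε0 hθ0 hθ1 ha₀ ha ha'
    have hfε := hfpos ε hε0
    have hca : c ≤ a := by
      rw [ha, div_mul_cancel₀ _ hb₀.ne']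
      have : 0 < (1 - c / b₀) * ε := mul_pos (by linarith) hε0
      linarith
    have ha0' : 0 < a' := by
      have h1 := mul_pos hθ0 (hfpos b₀ hb₀)
      have h2 : 0 < (1 - c / b₀) * f ε := mul_pos (by linarith) hfε
      linarith
    have haκ' : a' ≤ c * κ := by
      have : c / b₀ * f ε > 0 := mul_pos hθ0 hfε
      linarith
    have ha0 : 0 < a := hc0.trans_le hca
    have h1 : a₀ ≤ a * Φ (a₀ / a) := by
      have h2 := hΦa (u := a₀ / a) (v := t) (div_pos ha₀ ha0)
        (by rw [div_le_iff₀ ha0, ← hct]; nlinarith)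
      have h3 : a₀ / a * t ≤ t * Φ (a₀ / a) := (mul_le_mul_of_nonneg_left hΦt
        (div_pos ha₀ ha0).le).trans h2
      rw [mul_comm] at h3
      have h4 := le_of_mul_le_mul_left h3 ht0
      rwa [div_le_iff₀' ha0] at h4
    have h5 : f a₀ ≤ a' * Φ (f a₀ / a') := (hfmono _ _ ha₀ h1).trans h
    have hr : f a₀ / a₀ / κ * t = f a₀ / (c * κ) := by rw [← hct]; field_simp
    rw [hr]
    have hfa := hfpos a₀ ha₀
    have hx : f a₀ / (c * κ) ≤ f a₀ / a' := by gcongr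
    have h6 := hΦa (div_pos hfa (mul_pos hc0 hκ)) hx
    have h7 : f a₀ / a' ≤ Φ (f a₀ / a') := by rwa [div_le_iff₀' ha0']
    have h8 := (mul_le_mul_of_nonneg_left h7 (div_pos hfa (mul_pos hc0 hκ)).le).trans h6
    rw [mul_comm] at h8
    exact le_of_mul_le_mul_left h8 (div_pos hfa ha0')
  have hr : 1 < f a₀ / a₀ / κ := by rwa [one_lt_div hκ]
  have hpow : ∀ n : ℕ, (f a₀ / a₀ / κ) ^ n ≤ Φ ((f a₀ / a₀ / κ) ^ n) := by
    intro n
    induction n with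
    | zero => simp [hΦ1]
    | succ n ih =>
      rw [pow_succ']
      exact step _ (one_le_pow₀ hr.le) ih
  have hge : ∀ t, 0 < t → t ≤ Φ t := by
    intro t ht
    obtain ⟨n, hn⟩ := pow_unbounded_of_one_lt t hr
    have h1 := hΦa ht hn.le
    have h2 := (mul_le_mul_of_nonneg_left (hpow n) ht.le).trans h1
    rw [mul_comm] at h2
    exact le_of_mul_le_mul_left h2 (ht.trans hn)
  intro t ht
  refine le_antisymm ?_ (hge t ht)
  rcases le_total 1 t with h | h
  · simpa [hΦ1] using hΦa one_pos h
  · have h2t : 0 < 2 - t := by linarith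
    have h1 := hΦc.2 (show t ∈ Ioi (0 : ℝ) from ht) (show (2 : ℝ) ∈ Ioi (0 : ℝ) from mem_Ioi.2 two_pos)
      (show 0 ≤ 1 / (2 - t) by positivity)
      (show 0 ≤ (1 - t) / (2 - t) from div_nonneg (by linarith) h2t.le) (by field_simp; ring)
    simp only [smul_eq_mul] at h1
    rw [show 1 / (2 - t) * t + (1 - t) / (2 - t) * 2 = 1 by field_simp; ring, hΦ1] at h1
    have h2 := hge 2 two_pos
    rw [div_mul_eq_mul_div, div_mul_eq_mul_div, ← add_div, div_le_iff₀ h2t] at h1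
    nlinarith

theorem matFun_smul_add_smul_one_sub {n : ℕ} (f : ℝ → ℝ) {P : Matrix (Fin n) (Fin n) ℂ}
    (hP : P.IsHermitian) (hPP : P * P = P) (x y : ℝ) :
    matFun f (x • P + y • (1 - P)) = f x • P + f y • (1 - P) := by
  have hsa : IsSelfAdjoint P := hP
  have hspec : spectrum ℝ P ⊆ {0, 1} := IsIdempotentElem.spectrum_subset ℝ hPP
  have hfin : (spectrum ℝ P).Finite := P.finite_real_spectrum
  have lin : ∀ a b : ℝ, cfc (fun t : ℝ => b + (a - b) * t) P = a • P + b • (1 - P) := by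
    intro a b
    rw [cfc_const_add b (fun t => (a - b) * t) P, cfc_const_mul (a - b) (fun t => t) P,
      cfc_id' ℝ P, Algebra.algebraMap_eq_smul_one]
    module
  rw [matFun, ← lin x y, ← lin (f x) (f y),
    ← cfc_comp f (fun t : ℝ => y + (x - y) * t) P hsa ((hfin.image _).continuousOn _)]
  refine cfc_congr fun t ht => ?_
  rcases hspec ht with rfl | rfl <;> simp

theorem Matrix.PosDef.spectrum_real_pos {n : ℕ} {A : Matrix (Fin n) (Fin n) ℂ} (hA : A.PosDef)
    {x : ℝ} (hx : x ∈ spectrum ℝ A) : 0 < x := by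
  rw [hA.1.spectrum_real_eq_range_eigenvalues] at hx
  obtain ⟨i, rfl⟩ := hx
  exact hA.eigenvalues_pos i

theorem matFun_isHermitian {n : ℕ} (f : ℝ → ℝ) (A : Matrix (Fin n) (Fin n) ℂ) :
    (matFun f A).IsHermitian :=
  cfc_predicate f A

theorem matFun_sqrt_mul_self {n : ℕ} {A : Matrix (Fin n) (Fin n) ℂ} (hA : A.PosDef) :
    matFun Real.sqrt A * matFun Real.sqrt A = A := by
  have hsa : IsSelfAdjoint A := hA.1
  have hfin : (spectrum ℝ A).Finite := A.finite_real_spectrum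
  rw [matFun, ← cfc_mul _ _ A (hfin.continuousOn _) (hfin.continuousOn _)]
  conv_rhs => rw [← cfc_id ℝ A]
  exact cfc_congr fun t ht => Real.mul_self_sqrt (hA.spectrum_real_pos ht).le

theorem matFun_sqrt_mul_inv {n : ℕ} {A : Matrix (Fin n) (Fin n) ℂ} (hA : A.PosDef) :
    matFun Real.sqrt A * matFun (fun x => (Real.sqrt x)⁻¹) A = 1 := by
  have hsa : IsSelfAdjoint A := hA.1
  have hfin : (spectrum ℝ A).Finite := A.finite_real_spectrum
  rw [matFun, matFun, ← cfc_mul _ _ A (hfin.continuousOn _) (hfin.continuousOn _),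
    ← cfc_one ℝ A]
  exact cfc_congr fun t ht => mul_inv_cancel₀ (Real.sqrt_pos.2 (hA.spectrum_real_pos ht)).ne'

theorem loewnerLE.conj {n : ℕ} {A B : Matrix (Fin n) (Fin n) ℂ} (h : loewnerLE A B)
    {S : Matrix (Fin n) (Fin n) ℂ} (hS : S.IsHermitian) : loewnerLE (S * A * S) (S * B * S) := by
  have := h.mul_mul_conjTranspose_same S
  rwa [hS.eq, mul_sub, sub_mul] at this

theorem loewnerLE.posDef {n : ℕ} {A B : Matrix (Fin n) (Fin n) ℂ} (h : loewnerLE A B)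
    (hA : A.PosDef) : B.PosDef := by
  simpa using hA.add_posSemidef h

theorem loewnerLE.trans {n : ℕ} {A B C : Matrix (Fin n) (Fin n) ℂ} (h : loewnerLE A B)
    (h' : loewnerLE B C) : loewnerLE A C := by
  simpa [loewnerLE] using h.add h'

theorem loewnerLE.re_apply_le {n : ℕ} {A B : Matrix (Fin n) (Fin n) ℂ} (h : loewnerLE A B)
    (i : Fin n) : (A i i).re ≤ (B i i).re := by
  have := (Complex.le_def.1 (h.diag_nonneg (i := i))).1
  simpa using this

theorem kuboMean_mono {n : ℕ} {Φ : ℝ → ℝ} (hΦ : OpMonotone Φ) {A B C : Matrix (Fin n) (Fin n) ℂ}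
    (hA : A.PosDef) (hB : B.PosDef) (hC : C.PosDef) (h : loewnerLE B C) :
    loewnerLE (kuboMean Φ A B) (kuboMean Φ A C) := by
  have hI := matFun_isHermitian (fun x => (Real.sqrt x)⁻¹) A
  have hU : IsUnit (matFun (fun x => (Real.sqrt x)⁻¹) A) :=
    IsUnit.of_mul_eq_one_right _ (matFun_sqrt_mul_inv hA)
  have pd : ∀ X : Matrix (Fin n) (Fin n) ℂ, X.PosDef → (matFun (fun x => (Real.sqrt x)⁻¹) A * X *
      matFun (fun x => (Real.sqrt x)⁻¹) A).PosDef := by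
    intro X hX
    have := (Matrix.IsUnit.posDef_star_right_conjugate_iff hU (x := X)).2 hX
    rwa [star_eq_conjTranspose, hI.eq] at this
  exact (hΦ n _ _ (pd B hB) (pd C hC) (h.conj hI)).conj (matFun_isHermitian _ _)

/-- `E` is a projection onto a line, and `c` the corresponding diagonal entry of `A`. -/
theorem kuboMean_corner {n : ℕ} (Φ : ℝ → ℝ) {A E : Matrix (Fin n) (Fin n) ℂ} (hA : A.PosDef)
    (hE : E.IsHermitian) {c : ℝ} (hc : c ≠ 0) (hEA : E * A * E = c • E) (p k : ℝ) :
    kuboMean Φ A (p • (c⁻¹ • (A * E * A)) + k • (A - c⁻¹ • (A * E * A))) =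
      Φ p • (c⁻¹ • (A * E * A)) + Φ k • (A - c⁻¹ • (A * E * A)) := by
  obtain ⟨S, hS⟩ : ∃ S, S = matFun Real.sqrt A := ⟨_, rfl⟩
  obtain ⟨T, hT⟩ : ∃ T, T = matFun (fun x => (Real.sqrt x)⁻¹) A := ⟨_, rfl⟩
  have hSS : S * S = A := hS ▸ matFun_sqrt_mul_self hA
  have hST : S * T = 1 := by rw [hS, hT]; exact matFun_sqrt_mul_inv hA
  have hTS : T * S = 1 := mul_eq_one_comm.1 hST
  have hSH : S.IsHermitian := hS ▸ matFun_isHermitian _ _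
  have hQS : ∀ a b : ℝ, S * (a • (c⁻¹ • (S * E * S)) + b • (1 - c⁻¹ • (S * E * S))) * S =
      a • (c⁻¹ • (A * E * A)) + b • (A - c⁻¹ • (A * E * A)) := by
    intro a b
    have : S * (S * E * S) * S = A * E * A := by rw [← hSS]; noncomm_ring
    simp only [mul_add, add_mul, mul_sub, sub_mul, mul_smul_comm, smul_mul_assoc, this, mul_one,
      hSS]
  have hmid : T * (p • (c⁻¹ • (A * E * A)) + k • (A - c⁻¹ • (A * E * A))) * T =
      p • (c⁻¹ • (S * E * S)) + k • (1 - c⁻¹ • (S * E * S)) := by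
    rw [← hQS, ← mul_assoc, ← mul_assoc, hTS, one_mul, mul_assoc, hST, mul_one]
  have hQH : (c⁻¹ • (S * E * S)).IsHermitian := by
    have : (S * E * S).IsHermitian := by
      have := isHermitian_mul_mul_conjTranspose S hE
      rwa [hSH.eq] at this
    rw [IsHermitian, conjTranspose_smul, this.eq, star_trivial]
  have hQQ : (c⁻¹ • (S * E * S)) * (c⁻¹ • (S * E * S)) = c⁻¹ • (S * E * S) := by
    have : (S * E * S) * (S * E * S) = c • (S * E * S) := by
      calc _ = S * (E * (S * S) * E) * S := by noncomm_ring
        _ = _ := by rw [hSS, hEA, mul_smul_comm, smul_mul_assoc]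
    rw [smul_mul_assoc, mul_smul_comm, this, smul_smul c⁻¹ c, inv_mul_cancel₀ hc, one_smul]
  rw [kuboMean, ← hS, ← hT, hmid, matFun_smul_add_smul_one_sub Φ hQH hQQ, hQS]

/-- The real symmetric matrix with rows `(a, b)` and `(b, d)`. -/
noncomputable def symMat (a b d : ℝ) : Matrix (Fin 2) (Fin 2) ℂ := !![(a : ℂ), b; b, d]

theorem symMat_isHermitian (a b d : ℝ) : (symMat a b d).IsHermitian := by
  ext i j
  fin_cases i <;> fin_cases j <;> simp [symMat]

theorem symMat_sub (a b d a' b' d' : ℝ) :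
    symMat a b d - symMat a' b' d' = symMat (a - a') (b - b') (d - d') := by
  ext i j
  fin_cases i <;> fin_cases j <;> simp [symMat]

theorem symMat_add (a b d a' b' d' : ℝ) :
    symMat a b d + symMat a' b' d' = symMat (a + a') (b + b') (d + d') := by
  ext i j
  fin_cases i <;> fin_cases j <;> simp [symMat]

theorem smul_symMat (r a b d : ℝ) : r • symMat a b d = symMat (r * a) (r * b) (r * d) := by
  ext i j
  fin_cases i <;> fin_cases j <;> simp [symMat]

theorem one_eq_symMat : (1 : Matrix (Fin 2) (Fin 2) ℂ) = symMat 1 0 1 := by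
  ext i j
  fin_cases i <;> fin_cases j <;> simp [symMat]

theorem symMat_apply_re (a b d : ℝ) : (symMat a b d 0 0).re = a := by simp [symMat]

theorem symMat_posSemidef {a b d : ℝ} (ha : 0 < a) (h : b ^ 2 ≤ a * d) :
    (symMat a b d).PosSemidef := by
  have h1 : (symMat a b (b ^ 2 / a)).PosSemidef := by
    have := (posSemidef_vecMulVec_self_star ![(a : ℂ), b]).smul (inv_pos.2 ha).le
    convert this using 1
    ext i j
    have : (a : ℂ) ≠ 0 := by exact_mod_cast ha.ne'
    rw [symMat, Matrix.smul_apply, vecMulVec_apply]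
    fin_cases i <;> fin_cases j <;> simp <;> field_simp
  have h2 : (symMat 0 0 (d - b ^ 2 / a)).PosSemidef := by
    have h3 : 0 ≤ d - b ^ 2 / a := by rw [sub_nonneg, div_le_iff₀' ha]; exact h
    have := PosSemidef.diagonal (d := ![(0 : ℂ), ((d - b ^ 2 / a : ℝ) : ℂ)]) (by
      intro i
      fin_cases i
      · simp
      · exact Complex.zero_le_real.2 h3)
    convert this using 1
    ext i j
    fin_cases i <;> fin_cases j <;> simp [symMat]
  have := h1.add h2
  rwa [symMat_add, add_zero, add_zero, add_sub_cancel] at this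

theorem symMat_posDef {a b d : ℝ} (ha : 0 < a) (h : b ^ 2 < a * d) : (symMat a b d).PosDef := by
  refine (symMat_posSemidef ha h.le).posDef_iff_det_ne_zero.2 ?_
  rw [symMat, det_fin_two_of]
  exact_mod_cast (show 0 < a * d - b * b by linarith [sq b]).ne'

theorem loewnerLE_symMat {a b d a' b' d' : ℝ} (ha : a < a')
    (h : (b' - b) ^ 2 ≤ (a' - a) * (d' - d)) : loewnerLE (symMat a b d) (symMat a' b' d') := by
  rw [loewnerLE, symMat_sub]
  exact symMat_posSemidef (sub_pos.2 ha) h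

theorem matFun_symMat_of_isIdempotentElem (f : ℝ → ℝ) {u v w : ℝ}
    (h : symMat u v w * symMat u v w = symMat u v w) (x y : ℝ) :
    matFun f (symMat (x * u + y * (1 - u)) (x * v - y * v) (x * w + y * (1 - w))) =
      symMat (f x * u + f y * (1 - u)) (f x * v - f y * v) (f x * w + f y * (1 - w)) := by
  have := matFun_smul_add_smul_one_sub f (symMat_isHermitian u v w) h x y
  simp only [one_eq_symMat, symMat_sub, smul_symMat, symMat_add] at this
  convert this using 3 <;> ring

theorem matFun_symMat_diag (f : ℝ → ℝ) (x y : ℝ) :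
    matFun f (symMat x 0 y) = symMat (f x) 0 (f y) := by
  have h : symMat 1 0 0 * symMat 1 0 0 = symMat 1 0 0 := by
    ext i j
    fin_cases i <;> fin_cases j <;> simp [symMat]
  simpa using matFun_symMat_of_isIdempotentElem f h x y

theorem matFun_symMat_rotation (f : ℝ → ℝ) {θ : ℝ} (h0 : 0 ≤ θ) (h1 : θ ≤ 1) (x y : ℝ) :
    matFun f (symMat (θ * x + (1 - θ) * y) (√(θ * (1 - θ)) * (x - y)) ((1 - θ) * x + θ * y)) =
      symMat (θ * f x + (1 - θ) * f y) (√(θ * (1 - θ)) * (f x - f y))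
        ((1 - θ) * f x + θ * f y) := by
  have hs : (√(θ * (1 - θ)) : ℂ) * (√(θ * (1 - θ)) : ℂ) = θ * (1 - θ) := by
    exact_mod_cast Real.mul_self_sqrt (mul_nonneg h0 (sub_nonneg.2 h1))
  have h : symMat θ √(θ * (1 - θ)) (1 - θ) * symMat θ √(θ * (1 - θ)) (1 - θ) =
      symMat θ √(θ * (1 - θ)) (1 - θ) := by
    ext i j
    fin_cases i <;> fin_cases j <;> simp [symMat, hs] <;> ring
  convert matFun_symMat_of_isIdempotentElem f h x y using 3 <;> ring

theorem symMat_rotation_posDef {θ x y : ℝ} (h0 : 0 < θ) (h1 : θ < 1) (hx : 0 < x) (hy : 0 < y) :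
    (symMat (θ * x + (1 - θ) * y) (√(θ * (1 - θ)) * (x - y)) ((1 - θ) * x + θ * y)).PosDef := by
  have h2 : 0 < 1 - θ := sub_pos.2 h1
  refine symMat_posDef (by positivity) ?_
  rw [mul_pow, Real.sq_sqrt (by positivity)]
  nlinarith [mul_pos hx hy]

theorem kuboMean_symMat (Φ : ℝ → ℝ) {a b d : ℝ} (ha : 0 < a) (h : b ^ 2 < a * d) (p k : ℝ) :
    kuboMean Φ (symMat a b d) (symMat (p * a) (p * b) (p * (b ^ 2 / a) + k * (d - b ^ 2 / a))) =
      symMat (Φ p * a) (Φ p * b) (Φ p * (b ^ 2 / a) + Φ k * (d - b ^ 2 / a)) := by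
  have hE : symMat 1 0 0 * symMat a b d * symMat 1 0 0 = a • symMat 1 0 0 := by
    ext i j
    fin_cases i <;> fin_cases j <;> simp [symMat]
  have hA : a⁻¹ • (symMat a b d * symMat 1 0 0 * symMat a b d) = symMat a b (b ^ 2 / a) := by
    have : (a : ℂ) ≠ 0 := by exact_mod_cast ha.ne'
    ext i j
    fin_cases i <;> fin_cases j <;> simp [symMat] <;> field_simp
  have := kuboMean_corner Φ (symMat_posDef ha h) (symMat_isHermitian 1 0 0) ha.ne' hE p k
  simpa only [hA, symMat_sub, smul_symMat, symMat_add, sub_self, mul_zero, add_zero] using this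

theorem OMone.mono {f : ℝ → ℝ} (hf : OMone f) {x y : ℝ} (hx : 0 < x) (hxy : x ≤ y) :
    f x ≤ f y := by
  rcases hxy.eq_or_lt with rfl | hlt
  · exact le_rfl
  have h := hf.2.2 2 (symMat x 0 1) (symMat y 0 1) (symMat_posDef hx (by simpa))
    (symMat_posDef (hx.trans hlt) (by simpa using hx.trans hlt)) (loewnerLE_symMat hlt (by simp))
  simpa only [matFun_symMat_diag, symMat_apply_re] using h.re_apply_le 0

theorem OMone.concaveOn {f : ℝ → ℝ} (hf : OMone f) : ConcaveOn ℝ (Ioi 0) f := by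
  refine concaveOn_of_forall_pos hf.1 fun x y θ ε hx hy h0 h1 hε => ?_
  obtain ⟨M, hM⟩ : ∃ M, M = (√(θ * (1 - θ)) * (x - y)) ^ 2 / ε + ((1 - θ) * x + θ * y) := ⟨_, rfl⟩
  have h2 : 0 < 1 - θ := sub_pos.2 h1
  have hM0 : 0 < M := hM ▸ by positivity
  have hm : 0 < θ * x + (1 - θ) * y + ε := by positivity
  have h := hf.2.2 2 _ (symMat (θ * x + (1 - θ) * y + ε) 0 M) (symMat_rotation_posDef h0 h1 hx hy)
    (symMat_posDef hm (by simpa using mul_pos hm hM0))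
    (loewnerLE_symMat (by linarith) (by rw [hM]; field_simp; linarith))
  rw [matFun_symMat_rotation f h0.le h1.le, matFun_symMat_diag] at h
  simpa only [symMat_apply_re] using h.re_apply_le 0

theorem Subpreserves.corner_le {f Φ : ℝ → ℝ} (hsub : Subpreserves Φ f) (hf : OMone f)
    (hΦ : OMone Φ) (hΦtop : ∀ N, ∃ k, 0 < k ∧ N ≤ Φ k) {a b d a' b' d' : ℝ} (ha : 0 < a)
    (h : b ^ 2 < a * d) (ha' : 0 < a') (h' : b' ^ 2 < a' * d')
    (hfA : matFun f (symMat a b d) = symMat a' b' d') {p s l q : ℝ} (hp : 0 < p) (hps : p * a < s)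
    (hl : 0 < l) (hlp : l < Φ p * a) (hq : f s < q * a') : f l ≤ Φ q * a' := by
  have large : ∀ {α β γ δ : ℝ}, 0 < α → 0 < γ → ∃ k₀, 0 < k₀ ∧ ∀ k, k₀ ≤ k →
      β ^ 2 ≤ α * (k * γ - δ) := by
    intro α β γ δ hα hγ
    refine ⟨max 1 ((β ^ 2 / α + δ) / γ), by positivity, fun k hk => ?_⟩
    have h1 := (le_max_right _ _).trans hk
    rw [div_le_iff₀ hγ, ← le_sub_iff_add_le, div_le_iff₀' hα] at h1
    exact h1
  have hA := symMat_posDef ha h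
  have hA' := symMat_posDef ha' h'
  have hd : 0 < d - b ^ 2 / a := by rwa [sub_pos, div_lt_iff₀' ha]
  have hd' : 0 < d' - b' ^ 2 / a' := by rwa [sub_pos, div_lt_iff₀' ha']
  have hs : 0 < s := (mul_pos hp ha).trans hps
  have hfs := hf.1 s hs
  have hq0 : 0 < q := pos_of_mul_pos_left (hfs.trans hq) ha'.le
  have pdT : ∀ {a b d p k : ℝ}, 0 < a → 0 < d - b ^ 2 / a → 0 < p → 0 < k →
      (symMat (p * a) (p * b) (p * (b ^ 2 / a) + k * (d - b ^ 2 / a))).PosDef := by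
    intro a b d p k ha hd hp hk
    refine symMat_posDef (by positivity) ?_
    have : p * a * (p * (b ^ 2 / a) + k * (d - b ^ 2 / a)) =
      (p * b) ^ 2 + p * a * k * (d - b ^ 2 / a) := by field_simp
    rw [this]
    have : 0 < p * a * k * (d - b ^ 2 / a) := by positivity
    linarith
  obtain ⟨N, -, hN⟩ := large (β := Φ p * b) (γ := d - b ^ 2 / a) (δ := 1 - Φ p * (b ^ 2 / a))
    (sub_pos.2 hlp) hd
  obtain ⟨k, hk, hNk⟩ := hΦtop N
  obtain ⟨M, hM, hM'⟩ := large (β := p * b) (γ := 1)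
    (δ := p * (b ^ 2 / a) + k * (d - b ^ 2 / a)) (sub_pos.2 hps) one_pos
  have hfM := hf.1 M hM
  obtain ⟨K, hK, hK'⟩ := large (β := q * b') (γ := d' - b' ^ 2 / a')
    (δ := f M - q * (b' ^ 2 / a')) (sub_pos.2 hq) hd'
  have hB : (symMat s 0 M).PosDef := symMat_posDef hs (by simpa using mul_pos hs hM)
  have hfB : (symMat (f s) 0 (f M)).PosDef := symMat_posDef hfs (by simpa using mul_pos hfs hfM)
  have lower := kuboMean_mono hΦ.2.2 hA (pdT ha hd hp hk) hB
    (loewnerLE_symMat hps (by have := hM' M le_rfl; linarith))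
  rw [kuboMean_symMat Φ ha h] at lower
  have upper := kuboMean_mono hΦ.2.2 hA' hfB (pdT ha' hd' hq0 hK)
    (loewnerLE_symMat hq (by have := hK' K le_rfl; linarith))
  rw [kuboMean_symMat Φ ha' h'] at upper
  have hdiag : loewnerLE (symMat l 0 1) (kuboMean Φ (symMat a b d) (symMat s 0 M)) :=
    loewnerLE.trans (loewnerLE_symMat hlp (by have := hN (Φ k) hNk; linarith)) lower
  have hl1 : (symMat l 0 1).PosDef := symMat_posDef hl (by simpa)
  have hmid := hsub 2 _ _ hA hB
  rw [hfA, matFun_symMat_diag] at hmid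
  have hfinal := ((hf.2.2 2 _ _ hl1 (hdiag.posDef hl1) hdiag).trans hmid).trans upper
  rw [matFun_symMat_diag] at hfinal
  simpa only [symMat_apply_re] using hfinal.re_apply_le 0

theorem Subpreserves.mean_le {f Φ : ℝ → ℝ} (hsub : Subpreserves Φ f) (hf : OMone f)
    (hΦ : OMone Φ) (hΦtop : ∀ N, ∃ k, 0 < k ∧ N ≤ Φ k) {x y θ s : ℝ} (hx : 0 < x) (hy : 0 < y)
    (h0 : 0 < θ) (h1 : θ < 1) (hs : 0 < s) {a a' : ℝ} (ha : a = θ * x + (1 - θ) * y)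
    (ha' : a' = θ * f x + (1 - θ) * f y) :
    f (a * Φ (s / a)) ≤ a' * Φ (f s / a') := by
  have h2 : 0 < 1 - θ := sub_pos.2 h1
  have hfx := hf.1 x hx
  have hfy := hf.1 y hy
  have hfs := hf.1 s hs
  have ha0 : 0 < a := by rw [ha]; positivity
  have ha0' : 0 < a' := by rw [ha']; positivity
  have det : ∀ u v : ℝ, 0 < u → 0 < v → (√(θ * (1 - θ)) * (u - v)) ^ 2 <
      (θ * u + (1 - θ) * v) * ((1 - θ) * u + θ * v) := by
    intro u v hu hv
    rw [mul_pow, Real.sq_sqrt (by positivity)]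
    nlinarith [mul_pos hu hv]
  have key : ∀ p l q : ℝ, 0 < p → p * a < s → 0 < l → l < Φ p * a → f s < q * a' →
      f l ≤ Φ q * a' := by
    intro p l q hp hps hl hlp hq
    subst ha ha'
    exact hsub.corner_le hf hΦ hΦtop ha0 (det x y hx hy) ha0' (det _ _ hfx hfy)
      (matFun_symMat_rotation f h0.le h1.le x y) hp hps hl hlp hq
  have cont : ∀ {g : ℝ → ℝ} {t : ℝ}, OMone g → 0 < t → ContinuousAt g t := fun hg ht =>
    (hg.concaveOn.continuousOn isOpen_Ioi).continuousAt (Ioi_mem_nhds ht)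
  have hsa : 0 < s / a := div_pos hs ha0
  have hsa' : 0 < f s / a' := div_pos hfs ha0'
  have hr : Tendsto (fun r : ℝ => Φ (r * (s / a)) * a * r) (𝓝[<] 1) (𝓝 (a * Φ (s / a))) := by
    have : ContinuousAt (fun r : ℝ => Φ (r * (s / a)) * a * r) 1 := by
      have : ContinuousAt (fun r : ℝ => Φ (r * (s / a))) 1 :=
        ContinuousAt.comp (g := Φ) (by simpa using cont hΦ hsa) (by fun_prop)
      exact (this.mul continuousAt_const).mul continuousAt_id
    simpa [mul_comm] using this.tendsto.mono_left nhdsWithin_le_nhds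
  have hl := (cont hf (mul_pos ha0 (hΦ.1 _ hsa))).tendsto.comp hr
  have hq : Tendsto (fun q => Φ q * a') (𝓝[>] (f s / a')) (𝓝 (a' * Φ (f s / a'))) := by
    rw [mul_comm]
    exact ((cont hΦ hsa').tendsto.mono_left nhdsWithin_le_nhds).mul_const a'
  refine ge_of_tendsto hq ?_
  filter_upwards [self_mem_nhdsWithin] with q hq
  refine le_of_tendsto hl ?_
  filter_upwards [Ioo_mem_nhdsLT (zero_lt_one' ℝ)] with r hr
  have hΦr := hΦ.1 (r * (s / a)) (mul_pos hr.1 hsa)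
  refine key (r * (s / a)) _ q (mul_pos hr.1 hsa) ?_ (mul_pos (mul_pos hΦr ha0) hr.1) ?_
    ((div_lt_iff₀ ha0').1 hq)
  · rw [mul_assoc, div_mul_cancel₀ _ ha0.ne']
    exact mul_lt_of_lt_one_left hs hr.2
  · exact mul_lt_of_lt_one_right (mul_pos hΦr ha0) hr.2

theorem stmt_4 (f Φ : ℝ → ℝ) (hf : OMone f) (hΦ : OMone Φ) (hΦnt : ¬ OMTrivial Φ)
    (hΦstar0 : Filter.Tendsto (adjFun Φ) (nhdsWithin 0 (Set.Ioi 0)) (nhds 0))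
    (hsub : Subpreserves Φ f)
    (hf0 : Filter.Tendsto f (nhdsWithin 0 (Set.Ioi 0)) (nhds 0)) :
    ∀ t : ℝ, 0 < t → f t = t := by
  have hΦtop : ∀ N, ∃ k, 0 < k ∧ N ≤ Φ k := by
    intro N
    have hN : (0 : ℝ) < (max N 1)⁻¹ := by positivity
    obtain ⟨t, ht, hlt⟩ := (Filter.Eventually.and
      (eventually_mem_nhdsWithin (a := (0 : ℝ)) (s := Ioi 0))
      (hΦstar0.eventually_lt_const hN)).exists
    have ht' : 0 < t⁻¹ := inv_pos.2 ht
    exact ⟨t⁻¹, ht', (le_max_left _ _).trans ((inv_lt_inv₀ (hΦ.1 _ ht') (by positivity)).1 hlt).le⟩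
  exact (eq_id_or_eq_id_of_mean_le hf.1 hf.2.1 (fun _ _ => hf.mono) hf.concaveOn hΦ.1 hΦ.2.1
    hΦ.concaveOn hf0 fun _ _ _ _ _ _ hx hy h0 h1 hs ha ha' =>
      hsub.mean_le hf hΦ hΦtop hx hy h0 h1 hs ha ha').resolve_right fun h => hΦnt (Or.inr h)
end

section
/- Let α ∈ (0,1) and Φ ∈ OM_+^1. The following statements are equivalent: (I) the weighted harmonic representing function f_{!_α} is σ_Φ-subpreserving; (II) Φ = f_{!_β} for some β ∈ [0,1]; (III) every f ∈ OM_+^1 is σ_Φ-subpreserving. -/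
open Matrix Filter Set Topology
open scoped ComplexOrder

noncomputable def harmRep (a : ℝ) : ℝ → ℝ := fun t => ((1 - a) + a * t⁻¹)⁻¹

open scoped MatrixOrder

lemma Matrix.PosDef.convexComb {ι : Type*} {X Y : Matrix ι ι ℂ} (hX : X.PosDef) (hY : Y.PosDef)
    {b : ℝ} (hb : b ∈ Set.Icc (0 : ℝ) 1) : ((1 - b) • X + b • Y).PosDef := by
  rcases hb.1.eq_or_lt with rfl | h
  · simpa using hX
  · exact PosDef.posSemidef_add (hX.posSemidef.smul (by linarith [hb.2])) (hY.smul h)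

section
variable {ι κ : Type*} [Fintype ι] [Fintype κ] [DecidableEq ι] [DecidableEq κ]

lemma Matrix.continuousOn_spectrum (f : ℝ → ℝ) (A : Matrix ι ι ℂ) :
    ContinuousOn f (spectrum ℝ A) :=
  A.finite_real_spectrum.continuousOn f

lemma Matrix.PosDef.spectrum_pos {A : Matrix ι ι ℂ} (hA : A.PosDef) {x : ℝ}
    (hx : x ∈ spectrum ℝ A) : 0 < x :=
  hA.isStrictlyPositive.spectrum_pos hx

lemma Matrix.PosDef.cfc_posDef {A : Matrix ι ι ℂ} (hA : A.PosDef) {f : ℝ → ℝ}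
    (hf : ∀ t, 0 < t → 0 < f t) : (cfc f A).PosDef := by
  refine IsStrictlyPositive.posDef ?_
  refine (cfc_isStrictlyPositive_iff f A (A.continuousOn_spectrum f) hA.1).2 ?_
  exact fun x hx => hf x (hA.spectrum_pos hx)

lemma Matrix.PosDef.cfc_congr {A : Matrix ι ι ℂ} (hA : A.PosDef) {f g : ℝ → ℝ}
    (h : ∀ t, 0 < t → f t = g t) : cfc f A = cfc g A :=
  _root_.cfc_congr fun x hx => h x (hA.spectrum_pos hx)

lemma Matrix.PosDef.cfc_inv {A : Matrix ι ι ℂ} (hA : A.PosDef) {f : ℝ → ℝ}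
    (hf : ∀ t, 0 < t → 0 < f t) : cfc (fun t => (f t)⁻¹) A = (cfc f A)⁻¹ := by
  rw [Matrix.nonsing_inv_eq_ringInverse]
  exact _root_.cfc_inv f A (fun x hx => (hf x (hA.spectrum_pos hx)).ne')
    (A.continuousOn_spectrum f) hA.1

lemma Matrix.PosDef.cfc_inv_id {A : Matrix ι ι ℂ} (hA : A.PosDef) :
    cfc (fun t : ℝ => t⁻¹) A = A⁻¹ := by
  rw [hA.cfc_inv (f := fun t => t) fun t ht => ht]
  exact congrArg _ (cfc_id' ℝ A hA.1)

lemma Matrix.PosDef.cfc_comp_inv {A : Matrix ι ι ℂ} (hA : A.PosDef) (f : ℝ → ℝ) :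
    cfc (fun t => f t⁻¹) A = cfc f A⁻¹ := by
  rw [← hA.cfc_inv_id]
  exact cfc_comp' f (fun t => t⁻¹) A ((A.finite_real_spectrum.image _).continuousOn f)
    (A.continuousOn_spectrum _) hA.1

/-- Functional calculus respects intertwining relations. -/
lemma Matrix.cfc_mul_eq_mul_cfc {A : Matrix ι ι ℂ} {B : Matrix κ κ ℂ} (hA : A.IsHermitian)
    (hB : B.IsHermitian) (X : Matrix ι κ ℂ) (h : A * X = X * B) (f : ℝ → ℝ) :
    cfc f A * X = X * cfc f B := by
  classical
  set s := A.finite_real_spectrum.toFinset ∪ B.finite_real_spectrum.toFinset with hs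
  set p := Lagrange.interpolate s id f
  have hp : ∀ x ∈ s, f x = p.eval x := fun x hx =>
    (Lagrange.eval_interpolate_at_node f (Function.injective_id.injOn) hx).symm
  have hpA : cfc f A = Polynomial.aeval A p :=
    (_root_.cfc_congr fun x hx => hp x (by simp [hs, hx])).trans (cfc_polynomial p A hA)
  have hpB : cfc f B = Polynomial.aeval B p :=
    (_root_.cfc_congr fun x hx => hp x (by simp [hs, hx])).trans (cfc_polynomial p B hB)
  rw [hpA, hpB]
  clear hpA hpB hp
  induction p using Polynomial.induction_on with
  | C a => simp [Algebra.algebraMap_eq_smul_one]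
  | add p q hp hq => simp [Matrix.add_mul, Matrix.mul_add, hp, hq]
  | monomial n a ih =>
    simp only [pow_succ, map_mul, Polynomial.aeval_X, ← mul_assoc] at ih ⊢
    rw [Matrix.mul_assoc, h, ← Matrix.mul_assoc, ih, Matrix.mul_assoc]

lemma Matrix.IsHermitian.cfc_submatrix {A : Matrix ι ι ℂ} (hA : A.IsHermitian) (e : κ ≃ ι)
    (f : ℝ → ℝ) : cfc f (A.submatrix e e) = (cfc f A).submatrix e e := by
  have h := cfc_mul_eq_mul_cfc (hA.submatrix e) hA ((1 : Matrix κ κ ℂ).submatrix id e.symm)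
    (by
      ext i j
      rw [Matrix.mul_apply, Matrix.mul_apply, ← Equiv.sum_comp e]
      simp [Matrix.one_apply]) f
  ext i j
  have := congrFun (congrFun h i) (e j)
  rw [Matrix.mul_apply, Matrix.mul_apply, ← Equiv.sum_comp e] at this
  simpa [Matrix.one_apply] using this

lemma Matrix.cfc_fromBlocks {A : Matrix ι ι ℂ} {B : Matrix κ κ ℂ}
    (hA : A.IsHermitian) (hB : B.IsHermitian) (f : ℝ → ℝ) :
    cfc f (fromBlocks A 0 0 B) = fromBlocks (cfc f A) 0 0 (cfc f B) := by
  have hT : (fromBlocks A 0 0 B).IsHermitian := hA.fromBlocks (by simp) hB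
  have h₁ := cfc_mul_eq_mul_cfc hT hA (fromRows 1 0)
    (by simp [fromBlocks_mul_fromRows, fromRows_mul]) f
  have h₂ := cfc_mul_eq_mul_cfc hT hB (fromRows 0 1)
    (by simp [fromBlocks_mul_fromRows, fromRows_mul]) f
  rw [← fromBlocks_toBlocks (cfc f (fromBlocks A 0 0 B))] at h₁ h₂ ⊢
  simp only [fromBlocks_mul_fromRows, fromRows_mul, Matrix.mul_one, Matrix.mul_zero, add_zero,
    zero_add, Matrix.one_mul, Matrix.zero_mul, fromRows_inj.eq_iff] at h₁ h₂
  rw [h₁.1, h₁.2, h₂.1, h₂.2]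

lemma Matrix.cfc_diagonal (d : ι → ℝ) (f : ℝ → ℝ) :
    cfc f (diagonal fun i => (d i : ℂ)) = diagonal fun i => (f (d i) : ℂ) := by
  have hD : (diagonal fun i => (d i : ℂ)).IsHermitian := by
    simp [Matrix.IsHermitian, diagonal_conjTranspose, Pi.star_def]
  ext i j
  have h := cfc_mul_eq_mul_cfc hD (B := algebraMap ℝ (Matrix Unit Unit ℂ) (d j))
    (IsSelfAdjoint.algebraMap _ (.all (d j))) (Matrix.of fun i _ => if i = j then 1 else 0)
    (by
      ext i
      simp only [Matrix.mul_apply, diagonal_apply, Matrix.algebraMap_matrix_apply]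
      simp
      grind) f
  rw [cfc_algebraMap] at h
  have := congrFun (congrFun h i) ()
  simp [Matrix.mul_apply, Matrix.algebraMap_matrix_apply] at this
  rw [this, diagonal_apply]
  grind

lemma Matrix.PosDef.fromBlocks_zero {A : Matrix ι ι ℂ} {B : Matrix κ κ ℂ} (hA : A.PosDef)
    (hB : B.PosDef) : (fromBlocks A 0 0 B).PosDef := by
  have := hA.isUnit.invertible
  have h : (fromBlocks A 0 0 B).PosSemidef := by
    simpa using (hA.fromBlocks₁₁ 0 B).2 (by simpa using hB.posSemidef)
  rw [h.posDef_iff_isUnit, isUnit_iff_isUnit_det, det_fromBlocks_zero₂₁]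
  exact ((isUnit_iff_isUnit_det _).1 hA.isUnit).mul ((isUnit_iff_isUnit_det _).1 hB.isUnit)

lemma Matrix.PosDef.inv_le_inv {A B : Matrix ι ι ℂ} (hA : A.PosDef) (hB : B.PosDef)
    (h : A ≤ B) : B⁻¹ ≤ A⁻¹ := by
  have := hB.isUnit.invertible
  have := hA.inv.isUnit.invertible
  rw [Matrix.le_iff] at h ⊢
  have hAA := nonsing_inv_nonsing_inv A ((isUnit_iff_isUnit_det _).1 hA.isUnit)
  have h₁ := (hA.inv.fromBlocks₂₂ B 1).2 (by simpa [hAA] using h)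
  simpa using (hB.fromBlocks₁₁ 1 A⁻¹).1 h₁

end

lemma OpMonotone.cfc_le_cfc {f : ℝ → ℝ} (hf : OpMonotone f) {ι : Type*} [Fintype ι]
    [DecidableEq ι] {A B : Matrix ι ι ℂ} (hA : A.PosDef) (hB : B.PosDef) (h : A ≤ B) :
    cfc f A ≤ cfc f B := by
  let e := (Fintype.equivFin ι).symm
  have := hf _ (A.submatrix e e) (B.submatrix e e) (hA.submatrix e.injective)
    (hB.submatrix e.injective) (Matrix.PosSemidef.submatrix (M := B - A) h e)
  rw [loewnerLE, matFun, matFun, hA.1.cfc_submatrix, hB.1.cfc_submatrix] at this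
  rw [Matrix.le_iff, ← posSemidef_submatrix_equiv e]
  exact this

lemma OpMonotone.convexComb_le_cfc {g : ℝ → ℝ} (hg : OpMonotone g) {ι : Type*} [Fintype ι]
    [DecidableEq ι] {X Y : Matrix ι ι ℂ} (hX : X.PosDef) (hY : Y.PosDef) {c s η : ℝ}
    (hcs : c ^ 2 + s ^ 2 = 1) (hη : 0 < η) :
    c ^ 2 • cfc g X + s ^ 2 • cfc g Y ≤ cfc g ((1 + η) • (c ^ 2 • X + s ^ 2 • Y)) := by
  set C := c ^ 2 • X + s ^ 2 • Y with hC
  set D := (c * s) • (Y - X) with hD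
  set E := s ^ 2 • X + c ^ 2 • Y with hE
  let U : Matrix (ι ⊕ ι) (ι ⊕ ι) ℂ := fromBlocks (c • 1) (-s • 1) (s • 1) (c • 1)
  let V : Matrix (ι ⊕ ι) (ι ⊕ ι) ℂ := fromBlocks (c • 1) (s • 1) (-s • 1) (c • 1)
  have hVU : V * U = 1 := by
    simp only [U, V, fromBlocks_multiply, ← fromBlocks_one]
    congr 1 <;> simp only [Matrix.smul_mul, Matrix.mul_smul, Matrix.one_mul, smul_smul, ← add_smul]
    · rw [show c * c + s * s = 1 by linarith, one_smul]
    · rw [show -s * c + c * s = 0 by ring, zero_smul]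
    · rw [show c * -s + s * c = 0 by ring, zero_smul]
    · rw [show -s * -s + c * c = 1 by linarith, one_smul]
  have hUV : U * V = 1 := mul_eq_one_comm.1 hVU
  have hVstar : Uᴴ = V := by
    simp [U, V, fromBlocks_conjTranspose, conjTranspose_smul]
  have hT : (fromBlocks X 0 0 Y).PosDef := hX.fromBlocks_zero hY
  have hM : V * fromBlocks X 0 0 Y * U = fromBlocks C D D E := by
    simp only [U, V, fromBlocks_multiply]
    congr 1 <;> simp [hC, hD, hE, smul_smul] <;> module
  have hMpos : (fromBlocks C D D E).PosDef := by
    rw [← hM, ← hVstar]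
    refine hT.conjTranspose_mul_mul_same fun x y hxy => ?_
    simpa [hVU] using congrArg (V *ᵥ ·) hxy
  have hCpos : C.PosDef := hMpos.submatrix (e := Sum.inl) Sum.inl_injective
  have hEpos : E.PosDef := hMpos.submatrix (e := Sum.inr) Sum.inr_injective
  have hDh : Dᴴ = D := by
    simp [hD, conjTranspose_smul, hX.1.eq, hY.1.eq]
  have hηC := hCpos.smul hη
  set F := E + D * (η • C)⁻¹ * D with hF
  have hFpos : F.PosDef := hEpos.add_posSemidef <| by
    simpa [hDh] using hηC.inv.posSemidef.conjTranspose_mul_mul_same D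
  have hC' : ((1 + η) • C).PosDef := hCpos.smul (by linarith)
  have hle : fromBlocks C D D E ≤ fromBlocks ((1 + η) • C) 0 0 F := by
    have := hηC.isUnit.invertible
    have h := (hηC.fromBlocks₁₁ (-D) (D * (η • C)⁻¹ * D)).2
      (by simpa [hDh] using Matrix.PosSemidef.zero)
    rw [Matrix.le_iff]
    have hsub : fromBlocks ((1 + η) • C) 0 0 F - fromBlocks C D D E =
        fromBlocks (η • C) (-D) (-D)ᴴ (D * (η • C)⁻¹ * D) := by
      rw [sub_eq_add_neg, fromBlocks_neg, fromBlocks_add]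
      congr 1
      · module
      · simp
      · simp [hDh]
      · simp [hF]
    rwa [hsub]
  have hfle := hg.cfc_le_cfc hMpos (hC'.fromBlocks_zero hFpos) hle
  have hfM : cfc g (fromBlocks C D D E) = V * cfc g (fromBlocks X 0 0 Y) * U := by
    have := cfc_mul_eq_mul_cfc hT.1 hMpos.1 U
      (by rw [← hM, ← Matrix.mul_assoc, ← Matrix.mul_assoc, hUV, Matrix.one_mul]) g
    rw [Matrix.mul_assoc, this, ← Matrix.mul_assoc, hVU, Matrix.one_mul]
  rw [hfM, cfc_fromBlocks hX.1 hY.1, cfc_fromBlocks hC'.1 hFpos.1, Matrix.le_iff] at hfle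
  have h := hfle.submatrix Sum.inl
  rw [Matrix.le_iff]
  convert h using 1
  simp only [U, V, fromBlocks_multiply]
  ext i j
  simp [smul_smul, sq]

lemma OpMonotone.monotoneOn_s7 {g : ℝ → ℝ} (hg : OpMonotone g) : MonotoneOn g (Set.Ioi 0) := by
  intro a ha b hb hab
  have h := hg.cfc_le_cfc (ι := Unit) (A := diagonal fun _ => (a : ℂ))
    (B := diagonal fun _ => (b : ℂ)) (by simpa using ha) (by simpa using hb)
    (by simpa [Matrix.le_iff, diagonal_sub] using hab)
  rw [cfc_diagonal (fun _ => a), cfc_diagonal (fun _ => b)] at h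
  simpa [Matrix.le_iff, diagonal_sub, ← Complex.ofReal_sub] using h

lemma OpMonotone.scalar_convexComb_le {g : ℝ → ℝ} (hg : OpMonotone g) {x y b η : ℝ}
    (hx : 0 < x) (hy : 0 < y) (hb : b ∈ Set.Icc (0 : ℝ) 1) (hη : 0 < η) :
    (1 - b) * g x + b * g y ≤ g ((1 + η) * ((1 - b) * x + b * y)) := by
  have h := hg.convexComb_le_cfc (ι := Unit) (X := diagonal fun _ => (x : ℂ))
    (Y := diagonal fun _ => (y : ℂ)) (by simpa using hx) (by simpa using hy)
    (c := √(1 - b)) (s := √b) (η := η)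
    (by rw [Real.sq_sqrt (by linarith [hb.2]), Real.sq_sqrt hb.1]; ring) hη
  rw [Real.sq_sqrt (by linarith [hb.2]), Real.sq_sqrt hb.1] at h
  have e : (1 + η) • ((1 - b) • (Matrix.diagonal fun _ => (x : ℂ)) +
      b • (Matrix.diagonal fun _ => (y : ℂ))) =
      (diagonal fun _ => (((1 + η) * ((1 - b) * x + b * y) : ℝ) : ℂ) : Matrix Unit Unit ℂ) := by
    ext
    simp [mul_add]
  rw [e, cfc_diagonal (fun _ => x), cfc_diagonal (fun _ => y), cfc_diagonal (fun _ => _)] at h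
  have := Matrix.PosSemidef.diag_nonneg h (i := ())
  simp at this
  exact_mod_cast this

/-- `g t / t` is nonincreasing. -/
lemma OpMonotone.mul_le_mul_of_le {g : ℝ → ℝ} (hg : OpMonotone g) (hpos : ∀ t, 0 < t → 0 < g t)
    {t s : ℝ} (ht : 0 < t) (hts : t ≤ s) : t * g s ≤ s * g t := by
  have hs := ht.trans_le hts
  have key : ∀ b ∈ Set.Ioo 0 (t / s), b * g s ≤ g t := by
    intro b hb
    have hbs : b * s < t := (lt_div_iff₀ hs).1 hb.2
    have hb1 : b < 1 := hb.2.trans_le ((div_le_one hs).2 hts)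
    have hb1' : 0 < 1 - b := by linarith
    set x := (t - b * s) / (2 * (1 - b)) with hx
    have hxpos : 0 < x := div_pos (by linarith) (by linarith)
    have hm : (1 - b) * x + b * s = (t + b * s) / 2 := by
      rw [hx]; field_simp; ring
    have hbs0 := mul_pos hb.1 hs
    have h := hg.scalar_convexComb_le hxpos hs ⟨hb.1.le, hb1.le⟩
      (η := t / ((t + b * s) / 2) - 1)
      (by rw [sub_pos, one_lt_div (by linarith)]; linarith)
    rw [hm, add_sub_cancel, div_mul_cancel₀ _ (by linarith)] at h
    nlinarith [hpos x hxpos]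
  have hlim : Tendsto (fun b => b * g s) (𝓝[<] (t / s)) (𝓝 (t / s * g s)) :=
    ((continuous_id.mul continuous_const).tendsto _).mono_left nhdsWithin_le_nhds
  have := le_of_tendsto hlim (b := g t)
    (Filter.mem_of_superset (Ioo_mem_nhdsLT (div_pos ht hs)) key)
  rw [div_mul_eq_mul_div, div_le_iff₀ hs] at this
  linarith

lemma OpMonotone.convexComb_le_cfc_convexComb {g : ℝ → ℝ} (hg : OpMonotone g)
    (hpos : ∀ t, 0 < t → 0 < g t) {ι : Type*} [Fintype ι] [DecidableEq ι] {X Y : Matrix ι ι ℂ}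
    (hX : X.PosDef) (hY : Y.PosDef) {b : ℝ} (hb : b ∈ Set.Icc (0 : ℝ) 1) :
    (1 - b) • cfc g X + b • cfc g Y ≤ cfc g ((1 - b) • X + b • Y) := by
  set C := (1 - b) • X + b • Y with hC
  have hCpos : C.PosDef := hX.convexComb hY hb
  have key : ∀ η : ℝ, 0 < η → (1 - b) • cfc g X + b • cfc g Y ≤ (1 + η) • cfc g C := by
    intro η hη
    have h := hg.convexComb_le_cfc hX hY (c := √(1 - b)) (s := √b) (η := η)
      (by rw [Real.sq_sqrt (by linarith [hb.2]), Real.sq_sqrt hb.1]; ring) hη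
    rw [Real.sq_sqrt (by linarith [hb.2]), Real.sq_sqrt hb.1, ← hC] at h
    refine h.trans ?_
    have e₁ : cfc g ((1 + η) • C) = cfc (fun x => g ((1 + η) * x)) C :=
      (cfc_comp_const_mul (1 + η) g C ((C.finite_real_spectrum.image _).continuousOn g)
        hCpos.1).symm
    have e₂ : (1 + η) • cfc g C = cfc (fun x => (1 + η) * g x) C :=
      (cfc_const_mul (1 + η) g C (C.continuousOn_spectrum g)).symm
    rw [e₁, e₂]
    refine cfc_mono (fun x hx => ?_) (C.continuousOn_spectrum _) (C.continuousOn_spectrum _)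
    have hx := hCpos.spectrum_pos hx
    have := hg.mul_le_mul_of_le hpos hx (s := (1 + η) * x) (by nlinarith)
    exact le_of_mul_le_mul_left (by linarith) hx
  rw [Matrix.le_iff]
  have hadj : ∀ A : Matrix ι ι ℂ, (cfc g A).IsHermitian := fun A => cfc_predicate g A
  refine PosSemidef.of_dotProduct_mulVec_nonneg ((hadj C).sub
    (((hadj X).smul (.all (1 - b))).add ((hadj Y).smul (.all b)))) fun v => ?_
  have hlim : Tendsto (fun η : ℝ => star v ⬝ᵥ
      (((1 + η) • cfc g C - ((1 - b) • cfc g X + b • cfc g Y)) *ᵥ v)) (𝓝[>] 0)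
      (𝓝 (star v ⬝ᵥ (((1 + (0 : ℝ)) • cfc g C - ((1 - b) • cfc g X + b • cfc g Y)) *ᵥ v))) := by
    refine (Continuous.tendsto ?_ _).mono_left nhdsWithin_le_nhds
    fun_prop
  rw [add_zero, one_smul] at hlim
  refine ge_of_tendsto hlim ?_
  filter_upwards [self_mem_nhdsWithin] with η hη
  exact Matrix.PosSemidef.dotProduct_mulVec_nonneg (key η hη) v

section
variable {ι : Type*} [Fintype ι] [DecidableEq ι]

lemma one_sub_add_mul_pos {b t : ℝ} (hb : b ∈ Set.Icc (0 : ℝ) 1) (ht : 0 < t) :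
    0 < (1 - b) + b * t := by
  rcases hb.1.eq_or_lt with rfl | h
  · simp
  · nlinarith [hb.2, mul_pos h ht]

lemma harmRep_pos {b t : ℝ} (hb : b ∈ Set.Icc (0 : ℝ) 1) (ht : 0 < t) : 0 < harmRep b t :=
  inv_pos.2 (one_sub_add_mul_pos hb (inv_pos.2 ht))

lemma Matrix.PosDef.cfc_harmRep {A : Matrix ι ι ℂ} (hA : A.PosDef) {b : ℝ}
    (hb : b ∈ Set.Icc (0 : ℝ) 1) :
    cfc (harmRep b) A = ((1 - b) • (1 : Matrix ι ι ℂ) + b • A⁻¹)⁻¹ := by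
  refine (hA.cfc_inv fun t ht => one_sub_add_mul_pos hb (inv_pos.2 ht)).trans ?_
  congr 1
  refine (cfc_const_add (1 - b) (fun t => b * t⁻¹) A (A.continuousOn_spectrum _) hA.1).trans ?_
  rw [Algebra.algebraMap_eq_smul_one]
  congr 1
  refine (cfc_const_mul b (fun t => t⁻¹) A (A.continuousOn_spectrum _)).trans ?_
  rw [hA.cfc_inv_id]

lemma Matrix.PosDef.cfc_sqrt_inv {A : Matrix ι ι ℂ} (hA : A.PosDef) :
    cfc (fun x => (√x)⁻¹) A = (cfc Real.sqrt A)⁻¹ :=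
  hA.cfc_inv fun _ => Real.sqrt_pos.2

lemma Matrix.PosDef.cfc_sqrt_mul_self {A : Matrix ι ι ℂ} (hA : A.PosDef) :
    cfc Real.sqrt A * cfc Real.sqrt A = A := by
  refine (cfc_mul Real.sqrt Real.sqrt A (A.continuousOn_spectrum _)
    (A.continuousOn_spectrum _)).symm.trans ?_
  exact (hA.cfc_congr fun t ht => Real.mul_self_sqrt ht.le).trans (cfc_id' ℝ A hA.1)

lemma Matrix.PosDef.inv_mul_mul_inv {S B : Matrix ι ι ℂ} (hS : S.PosDef) (hB : B.PosDef) :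
    (S⁻¹ * B * S⁻¹).PosDef := by
  have := (IsUnit.posDef_star_left_conjugate_iff hS.inv.isUnit (x := B)).2 hB
  rwa [star_eq_conjTranspose, hS.inv.1.eq] at this

end

lemma kuboMean_congr {Φ Ψ : ℝ → ℝ} (h : ∀ t, 0 < t → Φ t = Ψ t) {n : ℕ}
    {A B : Matrix (Fin n) (Fin n) ℂ} (hA : A.PosDef) (hB : B.PosDef) :
    kuboMean Φ A B = kuboMean Ψ A B := by
  simp only [kuboMean, matFun]
  rw [hA.cfc_sqrt_inv, ((hA.cfc_posDef fun _ => Real.sqrt_pos.2).inv_mul_mul_inv hB).cfc_congr h]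

lemma kuboMean_harmRep {b : ℝ} (hb : b ∈ Set.Icc (0 : ℝ) 1) {n : ℕ}
    {A B : Matrix (Fin n) (Fin n) ℂ} (hA : A.PosDef) (hB : B.PosDef) :
    kuboMean (harmRep b) A B = ((1 - b) • A⁻¹ + b • B⁻¹)⁻¹ := by
  simp only [kuboMean, matFun]
  rw [hA.cfc_sqrt_inv]
  have hSS := hA.cfc_sqrt_mul_self
  have hS : (cfc Real.sqrt A).PosDef := hA.cfc_posDef fun _ => Real.sqrt_pos.2
  generalize cfc Real.sqrt A = S at hSS hS
  subst hSS
  have hSdet := (isUnit_iff_isUnit_det _).1 hS.isUnit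
  have hSi : S⁻¹ * S = 1 := nonsing_inv_mul S hSdet
  have hSi' : S * S⁻¹ = 1 := mul_nonsing_inv S hSdet
  rw [(hS.inv_mul_mul_inv hB).cfc_harmRep hb]
  have hinv : S⁻¹⁻¹ = S := nonsing_inv_nonsing_inv S hSdet
  have hconj : ∀ W : Matrix (Fin n) (Fin n) ℂ, S * W⁻¹ * S = (S⁻¹ * W * S⁻¹)⁻¹ := fun W => by
    simp only [Matrix.mul_inv_rev, hinv, Matrix.mul_assoc]
  rw [hconj]
  congr 1
  simp only [Matrix.mul_inv_rev, hinv, Matrix.mul_add, Matrix.add_mul, Matrix.mul_smul,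
    Matrix.smul_mul, Matrix.mul_one]
  congr 2
  simp only [← Matrix.mul_assoc, hSi, Matrix.one_mul]
  rw [Matrix.mul_assoc, hSi', Matrix.mul_one]

lemma OMone_harmRep {b : ℝ} (hb : b ∈ Set.Icc (0 : ℝ) 1) : OMone (harmRep b) := by
  refine ⟨fun t => harmRep_pos hb, by simp [harmRep], fun n A B hA hB h => ?_⟩
  simp only [matFun]
  rw [hA.cfc_harmRep hb, hB.cfc_harmRep hb]
  refine PosDef.inv_le_inv (PosDef.one.convexComb hB.inv hb) (PosDef.one.convexComb hA.inv hb) ?_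
  exact add_le_add le_rfl (smul_le_smul_of_nonneg_left (hA.inv_le_inv hB h) hb.1)

lemma Matrix.PosDef.cfc_adjFun {f : ℝ → ℝ} (hf : ∀ t, 0 < t → 0 < f t) {ι : Type*} [Fintype ι]
    [DecidableEq ι] {A : Matrix ι ι ℂ} (hA : A.PosDef) : cfc (adjFun f) A = (cfc f A⁻¹)⁻¹ := by
  refine (hA.cfc_inv fun t ht => hf _ (inv_pos.2 ht)).trans ?_
  rw [hA.cfc_comp_inv]

lemma adjFun_pos {f : ℝ → ℝ} (hf : ∀ t, 0 < t → 0 < f t) (t : ℝ) (ht : 0 < t) : 0 < adjFun f t :=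
  inv_pos.2 (hf _ (inv_pos.2 ht))

lemma OpMonotone.adjFun {f : ℝ → ℝ} (hf : OpMonotone f) (hpos : ∀ t, 0 < t → 0 < f t) :
    OpMonotone (adjFun f) := by
  intro n A B hA hB h
  simp only [matFun]
  rw [hA.cfc_adjFun hpos, hB.cfc_adjFun hpos]
  exact PosDef.inv_le_inv (hB.inv.cfc_posDef hpos) (hA.inv.cfc_posDef hpos)
    (hf.cfc_le_cfc hB.inv hA.inv (hA.inv_le_inv hB h))

lemma subpreserves_of_eq_harmRep {Φ : ℝ → ℝ} {b : ℝ} (hb : b ∈ Set.Icc (0 : ℝ) 1)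
    (hΦ : ∀ t, 0 < t → Φ t = harmRep b t) {f : ℝ → ℝ} (hf : OMone f) : Subpreserves Φ f := by
  intro n A B hA hB
  obtain ⟨hpos, -, hmono⟩ := hf
  have hfA : (cfc f A).PosDef := hA.cfc_posDef hpos
  have hfB : (cfc f B).PosDef := hB.cfc_posDef hpos
  rw [kuboMean_congr hΦ hA hB]
  simp only [matFun]
  rw [kuboMean_congr hΦ hfA hfB, kuboMean_harmRep hb hA hB, kuboMean_harmRep hb hfA hfB]
  have hK := hA.inv.convexComb hB.inv hb
  have h := (hmono.adjFun hpos).convexComb_le_cfc_convexComb (adjFun_pos hpos) hA.inv hB.inv hb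
  have hinv : ∀ {M : Matrix (Fin n) (Fin n) ℂ}, M.PosDef → M⁻¹⁻¹ = M := fun hM =>
    nonsing_inv_nonsing_inv _ ((isUnit_iff_isUnit_det _).1 hM.isUnit)
  rw [hA.inv.cfc_adjFun hpos, hB.inv.cfc_adjFun hpos, hK.cfc_adjFun hpos, hinv hA, hinv hB] at h
  have hKf := hK.inv.cfc_posDef hpos
  have := PosDef.inv_le_inv (hfA.inv.convexComb hfB.inv hb) hKf.inv h
  rwa [hinv hKf] at this


/-- For an operator monotone function affine on each side of `1`, the square of the left slope is at
most the product of the two slopes. -/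
lemma OpMonotone.slope_sq_le {g : ℝ → ℝ} (hg : OpMonotone g) {p q : ℝ}
    (hp : ∀ t, 0 < t → t ≤ 1 → g t = 1 + p * (t - 1)) (hq : ∀ t, 1 ≤ t → g t = 1 + q * (t - 1)) :
    p ^ 2 ≤ p * q := by
  let A : Matrix (Fin 2) (Fin 2) ℂ := !![9 / 10, -1 / 5; -1 / 5, 3 / 5]
  let d : Fin 2 → ℝ := ![13 / 10, 7 / 10]
  have hAdec : A = (1 / 2 : ℝ) • 1 + (1 / 10 : ℝ) • vecMulVec ![2, -1] (star ![2, -1]) := by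
    ext i j
    simp only [Matrix.add_apply, Matrix.smul_apply, vecMulVec_apply, Pi.star_apply]
    fin_cases i <;> fin_cases j <;> simp [A] <;> norm_num
  have hA : A.PosDef := by
    rw [hAdec]
    exact (PosDef.one.smul (by norm_num)).add_posSemidef
      ((posSemidef_vecMulVec_self_star _).smul (by norm_num))
  have hB : (Matrix.diagonal fun i => (d i : ℂ)).PosDef := by
    rw [posDef_diagonal_iff]
    intro i
    rw [Complex.zero_lt_real]
    fin_cases i <;> norm_num [d]
  have hAB : A ≤ Matrix.diagonal fun i => (d i : ℂ) := by
    rw [Matrix.le_iff]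
    have : (Matrix.diagonal fun i => (d i : ℂ)) - A =
        (1 / 10 : ℝ) • vecMulVec ![2, 1] (star ![2, 1]) := by
      ext i j
      simp only [Matrix.sub_apply, Matrix.smul_apply, vecMulVec_apply, Pi.star_apply]
      fin_cases i <;> fin_cases j <;> simp [A, d] <;> norm_num
    rw [this]
    exact (posSemidef_vecMulVec_self_star _).smul (by norm_num)
  have hA1 : A ≤ algebraMap ℝ _ 1 := by
    rw [Matrix.le_iff]
    have : algebraMap ℝ _ 1 - A = (1 / 10 : ℝ) • vecMulVec ![1, 2] (star ![1, 2]) := by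
      ext i j
      simp only [Matrix.sub_apply, Matrix.smul_apply, vecMulVec_apply, Pi.star_apply]
      fin_cases i <;> fin_cases j <;> simp [A, Matrix.algebraMap_matrix_apply] <;> norm_num
    rw [this]
    exact (posSemidef_vecMulVec_self_star _).smul (by norm_num)
  have hgA : cfc g A = (1 - p) • (1 : Matrix (Fin 2) (Fin 2) ℂ) + p • A := by
    have h₁ : cfc g A = cfc (fun t => (1 - p) + p * t) A := by
      refine _root_.cfc_congr fun x hx => ?_
      have hx1 : x ≤ 1 := (le_algebraMap_iff_spectrum_le hA.1).1 hA1 x hx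
      rw [hp x (hA.spectrum_pos hx) hx1]
      ring
    rw [h₁, ← Algebra.algebraMap_eq_smul_one]
    refine (cfc_const_add (1 - p) (fun t => p * t) A (A.continuousOn_spectrum _) hA.1).trans ?_
    exact congrArg _ (cfc_const_mul_id p A hA.1)
  have h := hg.cfc_le_cfc hA hB hAB
  rw [hgA, cfc_diagonal, Matrix.le_iff] at h
  have hdet := h.det_nonneg
  have h0 : g (13 / 10) = 1 + q * (3 / 10) := by rw [hq _ (by norm_num)]; norm_num
  have h1 : g (7 / 10) = 1 - p * (3 / 10) := by
    rw [hp _ (by norm_num) (by norm_num)]; ring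
  have e : ((Matrix.diagonal fun i => (g (d i) : ℂ)) -
      ((1 - p) • (1 : Matrix (Fin 2) (Fin 2) ℂ) + p • A)).det =
      ((3 / 100 * (p * q - p ^ 2) : ℝ) : ℂ) := by
    rw [det_fin_two]
    simp [d, A, h0, h1]
    ring
  rw [e, Complex.zero_le_real] at hdet
  linarith

lemma OpMonotone.convexComb_le {g : ℝ → ℝ} (hg : OpMonotone g) (hpos : ∀ t, 0 < t → 0 < g t)
    {x y b : ℝ} (hx : 0 < x) (hy : 0 < y) (hb : b ∈ Set.Icc (0 : ℝ) 1) :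
    (1 - b) * g x + b * g y ≤ g ((1 - b) * x + b * y) := by
  have h := hg.convexComb_le_cfc_convexComb hpos (ι := Unit) (X := diagonal fun _ => (x : ℂ))
    (Y := diagonal fun _ => (y : ℂ)) (by simpa using hx) (by simpa using hy) hb
  have e : (1 - b) • (Matrix.diagonal fun _ => (x : ℂ)) + b • (Matrix.diagonal fun _ => (y : ℂ)) =
      (diagonal fun _ => (((1 - b) * x + b * y : ℝ) : ℂ) : Matrix Unit Unit ℂ) := by
    ext
    simp
  rw [e, cfc_diagonal (fun _ => x), cfc_diagonal (fun _ => y), cfc_diagonal (fun _ => _)] at h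
  have := Matrix.PosSemidef.diag_nonneg h (i := ())
  simp at this
  exact_mod_cast this

lemma kuboMean_diagonal (Φ : ℝ → ℝ) {x : ℝ} (hx : 0 < x) (y : ℝ) {n : ℕ} :
    kuboMean Φ (Matrix.diagonal fun _ : Fin n => (x : ℂ)) (Matrix.diagonal fun _ => (y : ℂ)) =
      Matrix.diagonal fun _ => ((x * Φ (y / x) : ℝ) : ℂ) := by
  have hsx := Real.sqrt_pos.2 hx
  have h₁ : √x * Φ ((√x)⁻¹ * y * (√x)⁻¹) * √x = x * Φ (y / x) := by
    rw [mul_right_comm, Real.mul_self_sqrt hx.le, mul_right_comm, ← mul_inv,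
      Real.mul_self_sqrt hx.le, inv_mul_eq_div]
  simp only [kuboMean, matFun]
  rw [cfc_diagonal (fun _ => x), cfc_diagonal (fun _ => x), diagonal_mul_diagonal,
    diagonal_mul_diagonal]
  simp only [← Complex.ofReal_mul]
  rw [cfc_diagonal (fun _ => _), diagonal_mul_diagonal, diagonal_mul_diagonal]
  simp only [← Complex.ofReal_mul, h₁]

lemma Subpreserves.apply_le {Φ f : ℝ → ℝ} (h : Subpreserves Φ f) (hf : ∀ t, 0 < t → 0 < f t)
    {x y : ℝ} (hx : 0 < x) (hy : 0 < y) : f (x * Φ (y / x)) ≤ f x * Φ (f y / f x) := by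
  have := h 1 (Matrix.diagonal fun _ => (x : ℂ)) (Matrix.diagonal fun _ => (y : ℂ))
    (by simpa using hx) (by simpa using hy)
  rw [kuboMean_diagonal Φ hx] at this
  simp only [matFun] at this
  rw [cfc_diagonal (fun _ => _), cfc_diagonal (fun _ => x), cfc_diagonal (fun _ => y),
    kuboMean_diagonal Φ (hf x hx)] at this
  have := Matrix.PosSemidef.diag_nonneg this (i := 0)
  simp at this
  exact_mod_cast this

lemma Subpreserves.adjFun_le {Φ : ℝ → ℝ} (hΦ : ∀ t, 0 < t → 0 < Φ t) {a : ℝ}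
    (ha : a ∈ Set.Ioo (0 : ℝ) 1) (h : Subpreserves Φ (harmRep a)) {s t : ℝ}
    (hs : s ∈ Set.Ioo (0 : ℝ) 1) (ht : 0 < t) :
    adjFun Φ ((1 - s) + s * t) ≤ (1 - s) + s * adjFun Φ t := by
  have ha' : a ∈ Set.Icc (0 : ℝ) 1 := ⟨ha.1.le, ha.2.le⟩
  obtain ⟨l, hl, hsl⟩ : ∃ l : ℝ, 0 < l ∧ s * ((1 - a) + a * l) = a * l := by
    have h₁ : 0 < 1 - s := by linarith [hs.2]
    refine ⟨s * (1 - a) / (a * (1 - s)), ?_, ?_⟩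
    · exact div_pos (mul_pos hs.1 (by linarith [ha.2])) (mul_pos ha.1 h₁)
    · have := ha.1
      field_simp
      ring
  have hw : 0 < (1 - s) + s * t := one_sub_add_mul_pos ⟨hs.1.le, hs.2.le⟩ ht
  have hc : 0 < (1 - a) + a * l := one_sub_add_mul_pos ha' hl
  have hφt := adjFun_pos hΦ t ht
  have hφw := adjFun_pos hΦ _ hw
  have key := h.apply_le (fun _ => harmRep_pos ha') (inv_pos.2 hl) (inv_pos.2 (mul_pos hl ht))
  have e₁ : (l * t)⁻¹ / l⁻¹ = t⁻¹ := by field_simp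
  have e₂ : (harmRep a (l * t)⁻¹) / (harmRep a l⁻¹) = ((1 - s) + s * t)⁻¹ := by
    simp only [harmRep, inv_inv]
    have : (1 - a) + a * (l * t) = ((1 - a) + a * l) * ((1 - s) + s * t) := by
      linear_combination (1 - t) * hsl
    rw [this]
    field_simp
  have e₃ : ∀ u, Φ u⁻¹ = (adjFun Φ u)⁻¹ := fun u => by simp [adjFun]
  rw [e₁, e₂, e₃, e₃] at key
  simp only [harmRep, inv_inv, ← mul_inv] at key
  rw [inv_le_inv₀ (one_sub_add_mul_pos ha' (mul_pos hl hφt)) (mul_pos hc hφw)] at key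
  refine le_of_mul_le_mul_left ?_ hc
  linear_combination key + (1 - adjFun Φ t) * hsl

lemma exists_eq_harmRep_of_subpreserves {Φ : ℝ → ℝ} (hΦ : OMone Φ) {a : ℝ}
    (ha : a ∈ Set.Ioo (0 : ℝ) 1) (h : Subpreserves Φ (harmRep a)) :
    ∃ b ∈ Set.Icc (0 : ℝ) 1, ∀ t : ℝ, 0 < t → Φ t = harmRep b t := by
  obtain ⟨hpos, hone, hmono⟩ := hΦ
  have hg := hmono.adjFun hpos
  have hgpos := adjFun_pos hpos
  have hg1 : adjFun Φ 1 = 1 := by simp [adjFun, hone]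
  have hle : ∀ s ∈ Set.Ioo (0 : ℝ) 1, ∀ t, 0 < t →
      adjFun Φ ((1 - s) + s * t) ≤ (1 - s) + s * adjFun Φ t :=
    fun s hs t ht => h.adjFun_le hpos ha hs ht
  have hinv : ∀ t, Φ t = (adjFun Φ t⁻¹)⁻¹ := fun t => by simp [adjFun]
  generalize adjFun Φ = g at hg hgpos hg1 hle hinv
  have heq : ∀ s, 0 < s → s < 1 → ∀ t, 0 < t → g ((1 - s) + s * t) = (1 - s) + s * g t := by
    refine fun s hs0 hs1 t ht => (hle s ⟨hs0, hs1⟩ t ht).antisymm ?_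
    simpa [hg1] using hg.convexComb_le hgpos one_pos ht ⟨hs0.le, hs1.le⟩
  obtain ⟨q, hq⟩ : ∃ q, ∀ t, 1 ≤ t → g t = 1 + q * (t - 1) := by
    refine ⟨g 2 - 1, fun t ht => ?_⟩
    rcases ht.eq_or_lt with rfl | h1
    · simp [hg1]
    rcases lt_trichotomy t 2 with h2 | rfl | h2
    · have := heq (t - 1) (by linarith) (by linarith) 2 two_pos
      rw [show 1 - (t - 1) + (t - 1) * 2 = t by ring] at this
      linarith
    · ring
    · have ht1 : 0 < t - 1 := by linarith
      have := heq (t - 1)⁻¹ (inv_pos.2 ht1) (inv_lt_one_of_one_lt₀ (by linarith)) t (by linarith)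
      rw [show 1 - (t - 1)⁻¹ + (t - 1)⁻¹ * t = 2 by field_simp; ring] at this
      rw [this]
      field_simp
      ring
  obtain ⟨p, hp⟩ : ∃ p, ∀ t, 0 < t → t ≤ 1 → g t = 1 + p * (t - 1) := by
    refine ⟨2 * (1 - g (1 / 2)), fun t ht0 ht => ?_⟩
    rcases ht.eq_or_lt with rfl | h1
    · simp [hg1]
    have ht1 : 0 < 1 - t := by linarith
    rcases lt_trichotomy t (1 / 2) with h2 | rfl | h2
    · have := heq (2 * (1 - t))⁻¹ (inv_pos.2 (by linarith)) (inv_lt_one_of_one_lt₀ (by linarith))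
        t ht0
      rw [show 1 - (2 * (1 - t))⁻¹ + (2 * (1 - t))⁻¹ * t = 1 / 2 by field_simp; ring] at this
      rw [this]
      field_simp
      ring
    · ring
    · have := heq (2 * (1 - t)) (by linarith) (by linarith) (1 / 2) (by norm_num)
      rw [show 1 - 2 * (1 - t) + 2 * (1 - t) * (1 / 2) = t by ring] at this
      linarith
  have hslope := hg.slope_sq_le hp hq
  have hconc := hg.convexComb_le hgpos (x := 1 / 2) (y := 3 / 2) (b := 1 / 2) (by norm_num)
    (by norm_num) (by norm_num)
  have hmon := hg.monotoneOn_s7 (a := 1) (b := 2) (by simp) (by simp) (by norm_num)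
  rw [hp (1 / 2) (by norm_num) (by norm_num), hq (3 / 2) (by norm_num),
    show (1 - 1 / 2) * (1 / 2) + 1 / 2 * (3 / 2) = (1 : ℝ) by norm_num, hg1] at hconc
  rw [hg1, hq 2 (by norm_num)] at hmon
  have hq0 : 0 ≤ q := by linarith
  have hpq : p = q := by nlinarith
  subst hpq
  have hq1 : p ≤ 1 := by
    by_contra! hlt
    have h0 : 0 < (p - 1) / p := div_pos (by linarith) (by linarith)
    have := hgpos _ h0
    rw [hp _ h0 (by rw [div_le_one (by linarith)]; linarith)] at this
    field_simp at this
    linarith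
  refine ⟨p, ⟨hq0, hq1⟩, fun t ht => ?_⟩
  rw [hinv, harmRep]
  congr 1
  rcases le_total t⁻¹ 1 with h1 | h1
  · rw [hp _ (inv_pos.2 ht) h1]
    ring
  · rw [hq _ h1]
    ring

theorem stmt_7 (α : ℝ) (hα : α ∈ Set.Ioo (0 : ℝ) 1) (Φ : ℝ → ℝ) (hΦ : OMone Φ) :
    (Subpreserves Φ (harmRep α) ↔
      ∃ β ∈ Set.Icc (0 : ℝ) 1, ∀ t : ℝ, 0 < t → Φ t = harmRep β t) ∧
    ((∃ β ∈ Set.Icc (0 : ℝ) 1, ∀ t : ℝ, 0 < t → Φ t = harmRep β t) ↔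
      ∀ f : ℝ → ℝ, OMone f → Subpreserves Φ f) := by
  refine ⟨⟨exists_eq_harmRep_of_subpreserves hΦ hα, ?_⟩, ⟨?_, fun h => ?_⟩⟩
  · rintro ⟨β, hβ, h⟩
    exact subpreserves_of_eq_harmRep hβ h (OMone_harmRep ⟨hα.1.le, hα.2.le⟩)
  · rintro ⟨β, hβ, h⟩ f hf
    exact subpreserves_of_eq_harmRep hβ h hf
  · exact exists_eq_harmRep_of_subpreserves hΦ hα (h _ (OMone_harmRep ⟨hα.1.le, hα.2.le⟩))
end
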